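/- Let E ⊂ ℝ^N be a bounded domain, 1 < p < ∞, f : ℝ → ℝ measurable and bounded on compact sets, and w continuous on closure(E), positive and locally Lipschitz in E. Let u : E → ℝ be bounded, continuously differentiable in E, and a weak solution of −div(w(x) H(∇u)^{p−1}∇H(∇u)) = f(u) w(x) in E, i.e. ∫_E w(x) H(∇u(x))^{p−1} ⟨∇H(∇u(x)), ∇φ(x)⟩ dx = ∫_E f(u(x)) φ(x) w(x) dx for every φ ∈ C_c^∞(E), where the vector field H(∇u)^{p−1}∇H(∇u) is understood to be 0 at points where ∇u = 0. Then f(u(x)) = 0 for almost every x in the critical set {x ∈ E : ∇u(x) = 0}. -/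

import Mathlib

open MeasureTheory Set Metric
open scoped ENNReal NNReal RealInnerProductSpace Topology Classical

noncomputable section

/-- Divergence of a vector field on `ℝ^N`, computed coordinatewise. -/
def vdiv {N : ℕ} (σ : EuclideanSpace ℝ (Fin N) → EuclideanSpace ℝ (Fin N))
    (x : EuclideanSpace ℝ (Fin N)) : ℝ :=
  ∑ i, fderiv ℝ σ x (EuclideanSpace.single i 1) i

/-- The dual norm `H₀(x) = sup_{ξ ≠ 0} ⟨x, ξ⟩ / H(ξ)`. -/
def dualNorm {N : ℕ} (H : EuclideanSpace ℝ (Fin N) → ℝ) (x : EuclideanSpace ℝ (Fin N)) : ℝ :=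
  sSup ((fun ξ => ⟪x, ξ⟫ / H ξ) '' {ξ : EuclideanSpace ℝ (Fin N) | ξ ≠ 0})

/-- `H` is a norm on `ℝ^N`: convex, positive away from `0`, absolutely homogeneous. -/
structure IsAnisoNorm {N : ℕ} (H : EuclideanSpace ℝ (Fin N) → ℝ) : Prop where
  conv : ConvexOn ℝ Set.univ H
  pos : ∀ ξ, ξ ≠ 0 → 0 < H ξ
  hom : ∀ (t : ℝ) (ξ : EuclideanSpace ℝ (Fin N)), H (t • ξ) = |t| * H ξ

/-- `H` is `C²` away from the origin and uniformly elliptic: the Hessian of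
`ξ ↦ ½ H(ξ)²` is positive definite at every `ξ ≠ 0`. -/
def UniformlyElliptic {N : ℕ} (H : EuclideanSpace ℝ (Fin N) → ℝ) : Prop :=
  ContDiffOn ℝ 2 H {(0 : EuclideanSpace ℝ (Fin N))}ᶜ ∧
  ∀ ξ : EuclideanSpace ℝ (Fin N), ξ ≠ 0 → ∀ v : EuclideanSpace ℝ (Fin N), v ≠ 0 →
    0 < ⟪fderiv ℝ (gradient (fun z => H z ^ 2 / 2)) ξ v, v⟫

/-- The anisotropic vector field `H(∇u)^{p-1} ∇H(∇u)`, understood to be `0`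
at points where `∇u = 0`. -/
def aField {N : ℕ} (H : EuclideanSpace ℝ (Fin N) → ℝ) (p : ℝ)
    (u : EuclideanSpace ℝ (Fin N) → ℝ) (x : EuclideanSpace ℝ (Fin N)) :
    EuclideanSpace ℝ (Fin N) :=
  if gradient u x = 0 then 0 else H (gradient u x) ^ (p - 1) • gradient H (gradient u x)

/-- Weighted anisotropic perimeter of `E` relative to `S`:
`sup { ∫_E div σ : σ ∈ C¹_c(S; ℝ^N), ρ(σ(x)) ≤ w(x) for all x }`, valued in `[0,∞]`. -/
def periW {N : ℕ} (ρ w : EuclideanSpace ℝ (Fin N) → ℝ)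
    (E S : Set (EuclideanSpace ℝ (Fin N))) : ℝ≥0∞ :=
  ⨆ σ ∈ {σ : EuclideanSpace ℝ (Fin N) → EuclideanSpace ℝ (Fin N) |
      ContDiff ℝ 1 σ ∧ HasCompactSupport σ ∧ tsupport σ ⊆ S ∧ ∀ x, ρ (σ x) ≤ w x},
    ENNReal.ofReal (∫ x in E, vdiv σ x)

/-- Open convex cone with vertex at the origin (the case `S = ℝ^N` is allowed). -/
def IsOpenConvexCone {N : ℕ} (S : Set (EuclideanSpace ℝ (Fin N))) : Prop :=
  IsOpen S ∧ Convex ℝ S ∧ ∀ x ∈ S, ∀ t : ℝ, 0 < t → t • x ∈ S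

/-- The lineality space of `S`: directions along which `S` is translation invariant.
For a convex cone `Σ = ℝ^k × Σ̃` with `Σ̃` containing no lines this is `ℝ^k × {0}`. -/
def lineality {N : ℕ} (S : Set (EuclideanSpace ℝ (Fin N))) :
    Set (EuclideanSpace ℝ (Fin N)) :=
  {v | ∀ x ∈ S, ∀ t : ℝ, x + t • v ∈ S}

/-- A compactly supported `C¹` function is a uniform `C¹` limit of smooth functions supported in a
fixed compact neighbourhood of its support. -/
lemma exists_smooth_approx_C1 {V : Type*} [NormedAddCommGroup V] [InnerProductSpace ℝ V]
    [FiniteDimensional ℝ V] [MeasurableSpace V] [BorelSpace V] {E : Set V} (hE : IsOpen E)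
    {φ : V → ℝ} (hφ : ContDiff ℝ 1 φ) (hc : HasCompactSupport φ) (hsub : tsupport φ ⊆ E) :
    ∃ K, IsCompact K ∧ K ⊆ E ∧ tsupport φ ⊆ K ∧ ∀ δ > 0, ∃ ψ : V → ℝ,
      ContDiff ℝ (⊤ : ℕ∞) ψ ∧ tsupport ψ ⊆ K ∧
      ∀ x, |ψ x - φ x| ≤ δ ∧ ‖gradient ψ x - gradient φ x‖ ≤ δ := by
  obtain ⟨d, hd, hdE⟩ := IsCompact.exists_cthickening_subset_open hc hE hsub
  refine ⟨cthickening d (tsupport φ), IsCompact.cthickening hc, hdE,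
    self_subset_cthickening _, fun δ hδ => ?_⟩
  have hc' : HasCompactSupport (fderiv ℝ φ) := hc.fderiv ℝ
  have hcont' : Continuous (fderiv ℝ φ) := hφ.continuous_fderiv one_ne_zero
  have uc := Metric.uniformContinuous_iff.1 (hc.uniformContinuous_of_continuous hφ.continuous) δ hδ
  have uc' := Metric.uniformContinuous_iff.1 (hc'.uniformContinuous_of_continuous hcont') δ hδ
  obtain ⟨e, he, hu⟩ := uc
  obtain ⟨e', he', hu'⟩ := uc'
  set s : ℝ := min d (min e e') with hs
  have hspos : 0 < s := by positivity
  let b : ContDiffBump (0 : V) := ⟨s / 2, s, by positivity, by linarith⟩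
  let ψ : V → ℝ := convolution (b.normed volume) φ (ContinuousLinearMap.lsmul ℝ ℝ) volume
  have hli : LocallyIntegrable (b.normed volume) (volume : Measure V) :=
    b.continuous_normed.locallyIntegrable
  refine ⟨ψ, ?_, ?_, fun x => ⟨?_, ?_⟩⟩
  · exact b.hasCompactSupport_normed.contDiff_convolution_left _ b.contDiff_normed
      hφ.continuous.locallyIntegrable
  · refine closure_minimal ?_ isClosed_cthickening
    refine (support_convolution_subset _).trans ?_
    rw [b.support_normed_eq]
    rintro _ ⟨a, ha, y, hy, rfl⟩
    refine mem_cthickening_of_dist_le _ y d _ (subset_tsupport _ hy) ?_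
    have : dist a 0 < s := ha
    simp only [dist_zero_right] at this
    simp only [dist_eq_norm, add_sub_cancel_right]
    exact this.le.trans (min_le_left _ _)
  · rw [← Real.dist_eq]
    refine b.dist_normed_convolution_le hφ.continuous.aestronglyMeasurable fun y hy => ?_
    exact (hu (lt_of_lt_of_le hy ((min_le_right _ _).trans (min_le_left _ _)))).le
  · have h1 := hc.hasFDerivAt_convolution_right (ContinuousLinearMap.lsmul ℝ ℝ) hli hφ x
    have h2 : dist (convolution (b.normed volume) (fderiv ℝ φ)
        (ContinuousLinearMap.lsmul ℝ ℝ) volume x) (fderiv ℝ φ x) ≤ δ := by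
      refine b.dist_normed_convolution_le hcont'.aestronglyMeasurable fun y hy => ?_
      exact (hu' (lt_of_lt_of_le hy ((min_le_right _ _).trans (min_le_right _ _)))).le
    have h3 : fderiv ℝ ψ x = convolution (b.normed volume) (fderiv ℝ φ)
        (ContinuousLinearMap.lsmul ℝ ℝ) volume x := by
      rw [h1.fderiv]
      rfl
    rw [gradient, gradient, ← map_sub, LinearIsometryEquiv.norm_map, h3, ← dist_eq_norm]
    exact h2

/-- Weak formulations of divergence equations extend from smooth to `C¹` test functions. -/
lemma weak_formulation_C1 {V : Type*} [NormedAddCommGroup V] [InnerProductSpace ℝ V]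
    [FiniteDimensional ℝ V] [MeasurableSpace V] [BorelSpace V] {E : Set V} (hE : IsOpen E)
    {A : V → V} {g : V → ℝ} (hA : ∀ K ⊆ E, IsCompact K → IntegrableOn A K)
    (hg : ∀ K ⊆ E, IsCompact K → IntegrableOn g K)
    (hweak : ∀ φ : V → ℝ, ContDiff ℝ (⊤ : ℕ∞) φ → HasCompactSupport φ → tsupport φ ⊆ E →
      ∫ x in E, ⟪A x, gradient φ x⟫ = ∫ x in E, g x * φ x)
    {φ : V → ℝ} (hφ : ContDiff ℝ 1 φ) (hc : HasCompactSupport φ) (hsub : tsupport φ ⊆ E) :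
    ∫ x in E, ⟪A x, gradient φ x⟫ = ∫ x in E, g x * φ x := by
  obtain ⟨K, hK, hKE, hφK, happ⟩ := exists_smooth_approx_C1 hE hφ hc hsub
  have hAK := hA K hKE hK
  have hgK := hg K hKE hK
  have grad0 : ∀ ψ : V → ℝ, tsupport ψ ⊆ K → ∀ x ∉ K, gradient ψ x = 0 := by
    intro ψ hψ x hx
    rw [gradient, image_eq_zero_of_notMem_tsupport (f := fderiv ℝ ψ)
      (fun h => hx (hψ (tsupport_fderiv_subset ℝ h))), map_zero]
  have val0 : ∀ ψ : V → ℝ, tsupport ψ ⊆ K → ∀ x ∉ K, ψ x = 0 :=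
    fun ψ hψ x hx => image_eq_zero_of_notMem_tsupport (fun h => hx (hψ h))
  have red : ∀ ψ : V → ℝ, tsupport ψ ⊆ K →
      (∫ x in E, ⟪A x, gradient ψ x⟫ = ∫ x in K, ⟪A x, gradient ψ x⟫) ∧
      (∫ x in E, g x * ψ x = ∫ x in K, g x * ψ x) := by
    intro ψ hψ
    constructor
    · refine (setIntegral_eq_of_subset_of_forall_sdiff_eq_zero hE.measurableSet hKE ?_)
      intro x hx
      rw [grad0 ψ hψ x hx.2, inner_zero_right]
    · refine (setIntegral_eq_of_subset_of_forall_sdiff_eq_zero hE.measurableSet hKE ?_)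
      intro x hx
      rw [val0 ψ hψ x hx.2, mul_zero]
  have int1 : ∀ ψ : V → ℝ, ContDiff ℝ 1 ψ → IntegrableOn (fun x => ⟪A x, gradient ψ x⟫) K := by
    intro ψ hψ
    have hcg : Continuous (gradient ψ) :=
      (InnerProductSpace.toDual ℝ V).symm.continuous.comp (hψ.continuous_fderiv one_ne_zero)
    obtain ⟨C, hC⟩ := hK.exists_bound_of_continuousOn hcg.continuousOn
    refine Integrable.mono' (hAK.norm.mul_const C)
      (hAK.aestronglyMeasurable.inner hcg.aestronglyMeasurable) ?_
    filter_upwards [ae_restrict_mem hK.measurableSet] with x hx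
    exact (norm_inner_le_norm _ _).trans (mul_le_mul_of_nonneg_left (hC x hx) (norm_nonneg _))
  have int2 : ∀ ψ : V → ℝ, ContDiff ℝ 1 ψ → IntegrableOn (fun x => g x * ψ x) K := by
    intro ψ hψ
    exact hgK.mul_continuousOn hψ.continuous.continuousOn hK
  rw [(red φ hφK).1, (red φ hφK).2, ← sub_eq_zero, ← norm_eq_zero]
  refine le_antisymm (le_of_forall_pos_le_add fun ε hε => ?_) (norm_nonneg _)
  set M : ℝ := (∫ x in K, ‖A x‖) + ∫ x in K, ‖g x‖ with hM
  have hM0 : 0 ≤ M := add_nonneg (integral_nonneg fun _ => norm_nonneg _)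
    (integral_nonneg fun _ => norm_nonneg _)
  obtain ⟨ψ, hψ, hψK, hclose⟩ := happ (ε / (M + 1)) (by positivity)
  have hψ1 : ContDiff ℝ 1 ψ := hψ.of_le (by exact_mod_cast le_top)
  have hw := hweak ψ hψ (hK.of_isClosed_subset (isClosed_tsupport _) hψK) (hψK.trans hKE)
  rw [(red ψ hψK).1, (red ψ hψK).2] at hw
  have e1 : ‖(∫ x in K, ⟪A x, gradient ψ x⟫) - ∫ x in K, ⟪A x, gradient φ x⟫‖
      ≤ (∫ x in K, ‖A x‖) * (ε / (M + 1)) := by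
    rw [← integral_sub (int1 ψ hψ1) (int1 φ hφ), ← integral_mul_const]
    refine norm_integral_le_of_norm_le (hAK.norm.mul_const _) (Filter.Eventually.of_forall ?_)
    intro x
    rw [← inner_sub_right]
    exact (norm_inner_le_norm _ _).trans
      (mul_le_mul_of_nonneg_left (hclose x).2 (norm_nonneg _))
  have e2 : ‖(∫ x in K, g x * ψ x) - ∫ x in K, g x * φ x‖
      ≤ (∫ x in K, ‖g x‖) * (ε / (M + 1)) := by
    rw [← integral_sub (int2 ψ hψ1) (int2 φ hφ), ← integral_mul_const]
    refine norm_integral_le_of_norm_le (hgK.norm.mul_const _) (Filter.Eventually.of_forall ?_)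
    intro x
    rw [← mul_sub, norm_mul]
    exact mul_le_mul_of_nonneg_left (hclose x).1 (norm_nonneg _)
  have e3 : M * (ε / (M + 1)) ≤ ε := by
    rw [mul_div_assoc', div_le_iff₀ (by positivity)]
    nlinarith
  rw [Real.norm_eq_abs, abs_le] at *
  rw [hM, add_mul] at e3
  constructor <;> linarith [e1.1, e1.2, e2.1, e2.2]

/-- The increment of a `C¹` function is bounded by the integral of its gradient over the segment. -/
lemma enorm_sub_le_lintegral_gradient {V : Type*} [NormedAddCommGroup V] [InnerProductSpace ℝ V]
    [CompleteSpace V] {E : Set V} (hE : IsOpen E) {u : V → ℝ} (hu : ContDiffOn ℝ 1 u E) {x v : V}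
    (hseg : ∀ t ∈ Icc (0 : ℝ) 1, x + t • v ∈ E) :
    ‖u (x + v) - u x‖ₑ ≤ ‖v‖ₑ * ∫⁻ t in Icc (0 : ℝ) 1, ‖gradient u (x + t • v)‖ₑ := by
  have hd : ∀ t ∈ Icc (0 : ℝ) 1,
      HasDerivAt (fun s : ℝ => u (x + s • v)) (fderiv ℝ u (x + t • v) v) t := by
    intro t ht
    have h1 : HasFDerivAt u (fderiv ℝ u (x + t • v)) (x + t • v) :=
      ((hu.contDiffAt (hE.mem_nhds (hseg t ht))).differentiableAt one_ne_zero).hasFDerivAt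
    have h2 : HasDerivAt (fun s : ℝ => x + s • v) v t := by
      simpa using ((hasDerivAt_id t).smul_const v).const_add x
    exact h1.comp_hasDerivAt t h2
  have hcont : ContinuousOn (fun t : ℝ => fderiv ℝ u (x + t • v) v) (Icc 0 1) := by
    have h1 : ContinuousOn (fderiv ℝ u) E := hu.continuousOn_fderiv_of_isOpen hE le_rfl
    have h2 : ContinuousOn (fun t : ℝ => fderiv ℝ u (x + t • v)) (Icc 0 1) :=
      h1.comp (by fun_prop) hseg
    exact h2.clm_apply continuousOn_const
  have hftc := intervalIntegral.integral_eq_sub_of_hasDerivAt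
    (f := fun s : ℝ => u (x + s • v)) (a := 0) (b := 1)
    (by rw [uIcc_of_le zero_le_one]; exact hd)
    (ContinuousOn.intervalIntegrable (by rw [uIcc_of_le zero_le_one]; exact hcont))
  simp only [one_smul, zero_smul, add_zero] at hftc
  rw [← hftc, intervalIntegral.integral_of_le zero_le_one,
    ← lintegral_const_mul' _ _ enorm_ne_top, ← integral_Icc_eq_integral_Ioc]
  refine (enorm_integral_le_lintegral_enorm _).trans (lintegral_mono fun t => ?_)
  have : ‖gradient u (x + t • v)‖ₑ = ‖fderiv ℝ u (x + t • v)‖ₑ := by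
    rw [gradient, LinearIsometryEquiv.enorm_map]
  rw [this, mul_comm]
  exact ContinuousLinearMap.le_opENorm _ _

lemma mul_rpow_sub_one_self {p : ℝ} (hp : 1 < p) (a : ℝ≥0∞) : a * a ^ (p - 1) = a ^ p := by
  conv_lhs => rw [← ENNReal.rpow_one a, ← ENNReal.rpow_mul, one_mul]
  rw [← ENNReal.rpow_add_of_nonneg _ _ zero_le_one (by linarith)]
  congr 1; ring

lemma mul_rpow_sub_one_le_add {p : ℝ} (hp : 1 < p) (a b : ℝ≥0∞) :
    a * b ^ (p - 1) ≤ a ^ p + b ^ p := by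
  rcases le_total a b with h | h
  · calc a * b ^ (p - 1) ≤ b * b ^ (p - 1) := by gcongr
      _ = b ^ p := mul_rpow_sub_one_self hp b
      _ ≤ _ := le_add_self
  · calc a * b ^ (p - 1) ≤ a * a ^ (p - 1) := by
          gcongr
      _ = a ^ p := mul_rpow_sub_one_self hp a
      _ ≤ _ := le_self_add

lemma mul_rpow_sub_one_le_weighted {p : ℝ} (hp : 1 < p) (a b : ℝ≥0∞) {κ : ℝ≥0∞} (h0 : κ ≠ 0)
    (ht : κ ≠ ∞) : a * b ^ (p - 1) ≤ κ ^ (p - 1) * a ^ p + κ⁻¹ * b ^ p := by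
  have h := mul_rpow_sub_one_le_add hp (κ * a) b
  have e1 : a * b ^ (p - 1) = κ⁻¹ * (κ * a * b ^ (p - 1)) := by
    rw [← mul_assoc, ← mul_assoc, ENNReal.inv_mul_cancel h0 ht, one_mul]
  have e2 : κ ^ (p - 1) * a ^ p = κ⁻¹ * (κ * a) ^ p := by
    rw [ENNReal.mul_rpow_of_nonneg _ _ (by linarith), ← mul_assoc]
    congr 1
    rw [ENNReal.rpow_sub _ _ h0 ht, ENNReal.rpow_one, div_eq_mul_inv, mul_comm]
  rw [e1, e2, ← mul_add]
  gcongr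

/-- Selection of a base point `y` for which the weighted oscillation along segments is small when
`h` is supported in a set `S` of small measure. -/
lemma exists_oscillation_le {V : Type*} [NormedAddCommGroup V] [NormedSpace ℝ V]
    [FiniteDimensional ℝ V] [MeasurableSpace V] [BorelSpace V] {μ : Measure V}
    [μ.IsAddHaarMeasure] {p : ℝ} (hp : 1 < p) {h : V → ℝ≥0∞} (hm : Measurable h) {S D Y : Set V}
    (hS : MeasurableSet S) (hh : ∀ x ∉ S, h x = 0)
    (hY0 : μ Y ≠ 0) (hYt : μ Y ≠ ∞) (z : V) (L₁ L₂ β κ : ℝ≥0∞) (h0 : κ ≠ 0) (ht : κ ≠ ∞) :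
    ∃ y ∈ Y, ∫⁻ x in D, (h x ^ (p - 1) + β ^ (p - 1)) *
        (L₁ * (∫⁻ t in Icc (0 : ℝ) 1, h (x + t • y)) +
          L₂ * ∫⁻ t in Icc (0 : ℝ) 1, h (z + y + t • (x - z))) ∂μ ≤
      L₁ * (3 * ∫⁻ x, h x ^ p ∂μ + μ D * β ^ p) +
      L₂ * (2 * μ S * ∫⁻ x, h x ^ p ∂μ +
        μ D * (κ ^ (p - 1) * ∫⁻ x, h x ^ p ∂μ + κ⁻¹ * β ^ p * μ S)) / μ Y := by
  set Φ := ∫⁻ x, h x ^ p ∂μ with hΦ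
  set T : V → ℝ≥0∞ := fun x => h x ^ (p - 1) + β ^ (p - 1) with hT
  have hTm : Measurable T := by fun_prop
  have hpm : Measurable fun x => h x ^ p := hm.pow_const p
  have vol1 : (volume.restrict (Icc (0 : ℝ) 1)) univ = 1 := by simp
  have pp1 : ∀ x ∉ S, h x ^ (p - 1) = 0 := fun x hx => by
    rw [hh x hx, ENNReal.zero_rpow_of_pos (by linarith)]
  have m1 : Measurable fun q : V × V => ∫⁻ t in Icc (0 : ℝ) 1, h (q.1 + t • q.2) := by
    have : Measurable fun q : (V × V) × ℝ => h (q.1.1 + q.2 • q.1.2) :=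
      hm.comp (by fun_prop)
    exact this.lintegral_prod_right'
  have m2 : Measurable fun q : V × V => ∫⁻ t in Icc (0 : ℝ) 1, h (z + q.2 + t • (q.1 - z)) := by
    have : Measurable fun q : (V × V) × ℝ => h (z + q.1.2 + q.2 • (q.1.1 - z)) :=
      hm.comp (by fun_prop)
    exact this.lintegral_prod_right'
  have J1 : ∀ y, ∫⁻ x in D, T x * (L₁ * ∫⁻ t in Icc (0 : ℝ) 1, h (x + t • y)) ∂μ ≤
      L₁ * (3 * Φ + μ D * β ^ p) := by
    intro y
    have hxt : Measurable fun q : V × ℝ => h (q.1 + q.2 • y) := hm.comp (by fun_prop)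
    calc ∫⁻ x in D, T x * (L₁ * ∫⁻ t in Icc (0 : ℝ) 1, h (x + t • y)) ∂μ
        = ∫⁻ x in D, L₁ * (∫⁻ t in Icc (0 : ℝ) 1, T x * h (x + t • y)) ∂μ := by
          congr 1; ext x
          have hx : Measurable fun t : ℝ => h (x + t • y) := hm.comp (by fun_prop)
          rw [lintegral_const_mul _ hx]
          ring
      _ = L₁ * ∫⁻ x in D, (∫⁻ t in Icc (0 : ℝ) 1, T x * h (x + t • y)) ∂μ := by
          rw [lintegral_const_mul]
          exact ((hTm.comp measurable_fst).mul hxt).lintegral_prod_right'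
      _ = L₁ * ∫⁻ t in Icc (0 : ℝ) 1, ∫⁻ x in D, T x * h (x + t • y) ∂μ := by
          rw [lintegral_lintegral_swap]
          exact ((hTm.comp measurable_fst).mul hxt).aemeasurable
      _ ≤ L₁ * ∫⁻ t in Icc (0 : ℝ) 1, (3 * Φ + μ D * β ^ p) := by
          gcongr with t
          have htr : ∫⁻ x, h (x + t • y) ^ p ∂μ = Φ :=
            lintegral_add_right_eq_self (fun x => h x ^ p) (t • y)
          have hm' : Measurable fun x => h (x + t • y) ^ p :=
            (hm.comp (by fun_prop)).pow_const p
          calc ∫⁻ x in D, T x * h (x + t • y) ∂μ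
              ≤ ∫⁻ x in D, (2 * h (x + t • y) ^ p + h x ^ p + β ^ p) ∂μ := by
                refine lintegral_mono fun x => ?_
                have a1 := mul_rpow_sub_one_le_add hp (h (x + t • y)) (h x)
                have a2 := mul_rpow_sub_one_le_add hp (h (x + t • y)) β
                calc T x * h (x + t • y) = h (x + t • y) * h x ^ (p - 1)
                      + h (x + t • y) * β ^ (p - 1) := by simp only [hT]; ring
                  _ ≤ _ := add_le_add a1 a2
                  _ = _ := by ring
            _ = 2 * ∫⁻ x in D, h (x + t • y) ^ p ∂μ + ∫⁻ x in D, h x ^ p ∂μ + μ D * β ^ p := by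
                rw [lintegral_add_right _ measurable_const, lintegral_add_right _ hpm,
                  lintegral_const_mul _ hm', setLIntegral_const, mul_comm (β ^ p)]
            _ ≤ 2 * Φ + Φ + μ D * β ^ p := by
                gcongr
                · rw [← htr]; exact setLIntegral_le_lintegral _ _
                · exact setLIntegral_le_lintegral _ _
            _ = _ := by ring
      _ = _ := by rw [lintegral_const, vol1, mul_one]
  have prod1 : (∫⁻ x, h x ^ (p - 1) ∂μ) * (∫⁻ x, h x ∂μ) ≤ 2 * μ S * Φ := by
    have hind : ∫⁻ y, S.indicator (fun _ => (1 : ℝ≥0∞)) y ∂μ = μ S := by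
      rw [lintegral_indicator_const hS, one_mul]
    calc (∫⁻ x, h x ^ (p - 1) ∂μ) * (∫⁻ x, h x ∂μ)
        = ∫⁻ x, ∫⁻ y, h y * h x ^ (p - 1) ∂μ ∂μ := by
          rw [← lintegral_mul_const _ (hm.pow_const _)]
          congr 1; ext x
          rw [lintegral_mul_const _ hm, mul_comm]
      _ ≤ ∫⁻ x, ∫⁻ y, (S.indicator (fun _ => (1 : ℝ≥0∞)) x * h y ^ p
            + S.indicator (fun _ => (1 : ℝ≥0∞)) y * h x ^ p) ∂μ ∂μ := by
          gcongr with x y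
          by_cases hx : x ∈ S
          · by_cases hy : y ∈ S
            · simpa [hx, hy] using mul_rpow_sub_one_le_add hp (h y) (h x)
            · simp [hh y hy]
          · simp [pp1 x hx]
      _ = ∫⁻ x, (S.indicator (fun _ => (1 : ℝ≥0∞)) x * Φ + μ S * h x ^ p) ∂μ := by
          congr 1; ext x
          rw [lintegral_add_left (by fun_prop), lintegral_const_mul _ hpm, lintegral_mul_const _
            (measurable_const.indicator hS), hind]
      _ = 2 * μ S * Φ := by
          rw [lintegral_add_right _ (by fun_prop), lintegral_const_mul _ hpm, lintegral_mul_const _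
            (measurable_const.indicator hS), hind]
          ring
  have prod2 : β ^ (p - 1) * (∫⁻ x, h x ∂μ) ≤ κ ^ (p - 1) * Φ + κ⁻¹ * β ^ p * μ S := by
    calc β ^ (p - 1) * (∫⁻ x, h x ∂μ) = ∫⁻ x, h x * β ^ (p - 1) ∂μ := by
          rw [lintegral_mul_const _ hm, mul_comm]
      _ ≤ ∫⁻ x, (κ ^ (p - 1) * h x ^ p + S.indicator (fun _ => κ⁻¹ * β ^ p) x) ∂μ := by
          gcongr with x
          by_cases hx : x ∈ S
          · simpa [hx] using mul_rpow_sub_one_le_weighted hp (h x) β h0 ht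
          · simp [hh x hx]
      _ = _ := by
          rw [lintegral_add_left (by fun_prop), lintegral_const_mul _ hpm,
            lintegral_indicator_const hS]
  have J2 : ∫⁻ y in Y, ∫⁻ x in D, T x *
      (L₂ * ∫⁻ t in Icc (0 : ℝ) 1, h (z + y + t • (x - z))) ∂μ ∂μ ≤
      L₂ * (2 * μ S * Φ + μ D * (κ ^ (p - 1) * Φ + κ⁻¹ * β ^ p * μ S)) := by
    calc ∫⁻ y in Y, ∫⁻ x in D, T x *
          (L₂ * ∫⁻ t in Icc (0 : ℝ) 1, h (z + y + t • (x - z))) ∂μ ∂μ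
        = ∫⁻ x in D, ∫⁻ y in Y, T x *
          (L₂ * ∫⁻ t in Icc (0 : ℝ) 1, h (z + y + t • (x - z))) ∂μ ∂μ := by
          rw [lintegral_lintegral_swap]
          exact ((hTm.comp measurable_snd).mul
            ((m2.comp measurable_swap).const_mul L₂)).aemeasurable
      _ ≤ ∫⁻ x in D, T x * (L₂ * ∫⁻ y, h y ∂μ) ∂μ := by
          gcongr with x
          have m3 : Measurable fun y => ∫⁻ t in Icc (0 : ℝ) 1, h (z + y + t • (x - z)) :=
            m2.comp (by fun_prop : Measurable fun y : V => (x, y))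
          rw [lintegral_const_mul _ (m3.const_mul _), lintegral_const_mul _ m3]
          refine mul_le_mul_right (mul_le_mul_right ?_ _) _
          calc ∫⁻ y in Y, (∫⁻ t in Icc (0 : ℝ) 1, h (z + y + t • (x - z))) ∂μ
              ≤ ∫⁻ y, (∫⁻ t in Icc (0 : ℝ) 1, h (z + y + t • (x - z))) ∂μ :=
                setLIntegral_le_lintegral _ _
            _ = ∫⁻ t in Icc (0 : ℝ) 1, ∫⁻ y, h (z + y + t • (x - z)) ∂μ := by
                rw [lintegral_lintegral_swap]
                have : Measurable fun q : V × ℝ => h (z + q.1 + q.2 • (x - z)) :=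
                  hm.comp (by fun_prop)
                exact this.aemeasurable
            _ = ∫⁻ t in Icc (0 : ℝ) 1, ∫⁻ y, h y ∂μ := by
                congr 1; ext t
                rw [← lintegral_add_right_eq_self h (z + t • (x - z))]
                congr 1; ext y; congr 1; abel
            _ = ∫⁻ y, h y ∂μ := by rw [lintegral_const, vol1, mul_one]
      _ = L₂ * ((∫⁻ x in D, h x ^ (p - 1) ∂μ) * (∫⁻ y, h y ∂μ)
            + μ D * (β ^ (p - 1) * ∫⁻ y, h y ∂μ)) := by
          rw [lintegral_mul_const _ hTm, lintegral_add_right _ measurable_const,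
            setLIntegral_const]
          ring
      _ ≤ _ := by
          refine mul_le_mul_right (add_le_add (le_trans ?_ prod1)
            (mul_le_mul_right prod2 _)) _
          exact mul_le_mul_left (setLIntegral_le_lintegral _ _) _
  have mJ2 : Measurable fun y => ∫⁻ x in D, T x *
      (L₂ * ∫⁻ t in Icc (0 : ℝ) 1, h (z + y + t • (x - z))) ∂μ :=
    Measurable.lintegral_prod_right' (f := fun q : V × V => T q.2 *
      (L₂ * ∫⁻ t in Icc (0 : ℝ) 1, h (z + q.1 + t • (q.2 - z))))
      ((hTm.comp measurable_snd).mul ((m2.comp measurable_swap).const_mul L₂))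
  obtain ⟨y, hy, hle⟩ := exists_le_setLAverage hY0 hYt mJ2.aemeasurable
  refine ⟨y, hy, ?_⟩
  have mx1 : Measurable fun x => T x * (L₁ * ∫⁻ t in Icc (0 : ℝ) 1, h (x + t • y)) :=
    hTm.mul ((m1.comp (by fun_prop : Measurable fun x : V => (x, y))).const_mul _)
  simp only [mul_add]
  rw [lintegral_add_left mx1]
  simp only [← mul_add]
  refine add_le_add (J1 y) (hle.trans ?_)
  rw [setLAverage_eq]
  gcongr

/-- Cutoff functions between concentric balls, with a scale invariant gradient bound. -/
lemma exists_cutoff (V : Type*) [NormedAddCommGroup V] [InnerProductSpace ℝ V]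
    [FiniteDimensional ℝ V] :
    ∃ C₀ : ℝ, 0 ≤ C₀ ∧ ∀ (z : V) (r : ℝ), 0 < r → ∃ η : V → ℝ,
      ContDiff ℝ 1 η ∧ (∀ x, 0 ≤ η x ∧ η x ≤ 1) ∧ (∀ x ∈ closedBall z r, η x = 1) ∧
      tsupport η ⊆ closedBall z (2 * r) ∧ ∀ x, ‖gradient η x‖ ≤ C₀ / r := by
  let b : ContDiffBump (0 : V) := ⟨1, 2, one_pos, one_lt_two⟩
  have hb : ContDiff ℝ 1 b := b.contDiff
  obtain ⟨C, hC⟩ := (hb.continuous_fderiv one_ne_zero).bounded_above_of_compact_support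
    (b.hasCompactSupport.fderiv ℝ)
  refine ⟨C, (norm_nonneg _).trans (hC 0), fun z r hr => ⟨fun x => b (r⁻¹ • (x - z)), ?_,
    fun x => ⟨b.nonneg, b.le_one⟩, fun x hx => ?_, ?_, fun x => ?_⟩⟩
  · exact hb.comp (by fun_prop)
  · refine b.one_of_mem_closedBall ?_
    rw [mem_closedBall_zero_iff, norm_smul, norm_inv, Real.norm_of_nonneg hr.le, ← dist_eq_norm]
    rw [mem_closedBall] at hx
    exact (inv_mul_le_iff₀ hr).2 (by simpa [b] using hx)
  · refine closure_minimal (fun x hx => ?_) isClosed_closedBall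
    have h1 : r⁻¹ • (x - z) ∈ Function.support b := hx
    rw [b.support_eq, mem_ball_zero_iff, norm_smul, norm_inv, Real.norm_of_nonneg hr.le,
      inv_mul_lt_iff₀ hr, ← dist_eq_norm] at h1
    rw [mem_closedBall, mul_comm]
    exact h1.le
  · have h1 : HasFDerivAt (fun x => r⁻¹ • (x - z)) (r⁻¹ • ContinuousLinearMap.id ℝ V) x :=
      ((hasFDerivAt_id x).sub_const z).const_smul r⁻¹
    have h2 := ((hb.differentiable one_ne_zero) (r⁻¹ • (x - z))).hasFDerivAt.comp x h1
    have h3 : fderiv ℝ (fun x => b (r⁻¹ • (x - z))) x = r⁻¹ • fderiv ℝ b (r⁻¹ • (x - z)) := by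
      rw [show (fun x => b (r⁻¹ • (x - z))) = b ∘ (fun x => r⁻¹ • (x - z)) from rfl, h2.fderiv]
      ext v; simp
    rw [gradient, LinearIsometryEquiv.norm_map, h3, norm_smul, norm_inv, Real.norm_of_nonneg hr.le,
      div_eq_inv_mul]
    gcongr
    exact hC _

/-- `u` is a `C¹` weak solution of `-div A = g`, where on the ball of radius `R` around `z` the
field `A` is coercive and has `(p-1)`-growth with respect to `∇u`, and `g` is bounded. -/
structure IsFluxSolution {V : Type*} [NormedAddCommGroup V] [InnerProductSpace ℝ V]
    [FiniteDimensional ℝ V] [MeasurableSpace V] [BorelSpace V]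
    (E : Set V) (u : V → ℝ) (A : V → V) (g : V → ℝ) (p c C : ℝ) (z : V) (R : ℝ) : Prop where
  isOpen : IsOpen E
  contDiffOn : ContDiffOn ℝ 1 u E
  one_lt : 1 < p
  c_pos : 0 < c
  C_nonneg : 0 ≤ C
  R_pos : 0 < R
  ball_subset : closedBall z R ⊆ E
  coercive : ∀ x ∈ closedBall z R, c * ‖gradient u x‖ ^ p ≤ ⟪A x, gradient u x⟫
  growth : ∀ x ∈ closedBall z R, ‖A x‖ ≤ C * ‖gradient u x‖ ^ (p - 1)
  source_le : ∀ x ∈ closedBall z R, |g x| ≤ C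
  integrableOn_flux : IntegrableOn A (closedBall z R)
  integrableOn_source : IntegrableOn g (closedBall z R)
  weak : ∀ φ : V → ℝ, ContDiff ℝ 1 φ → HasCompactSupport φ → tsupport φ ⊆ E →
    ∫ x in E, ⟪A x, gradient φ x⟫ = ∫ x in E, g x * φ x

lemma continuous_gradient_of_contDiff {V : Type*} [NormedAddCommGroup V] [InnerProductSpace ℝ V]
    [CompleteSpace V] {φ : V → ℝ} (hφ : ContDiff ℝ 1 φ) :
    Continuous (gradient φ) :=
  (InnerProductSpace.toDual ℝ V).symm.continuous.comp (hφ.continuous_fderiv one_ne_zero)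

lemma continuousOn_gradient_of_contDiffOn {V : Type*} [NormedAddCommGroup V]
    [InnerProductSpace ℝ V] [CompleteSpace V] {E : Set V} (hE : IsOpen E) {u : V → ℝ}
    (hu : ContDiffOn ℝ 1 u E) : ContinuousOn (gradient u) E :=
  (InnerProductSpace.toDual ℝ V).symm.continuous.comp_continuousOn
    (hu.continuousOn_fderiv_of_isOpen hE le_rfl)

lemma enorm_rpow_eq_ofReal {V : Type*} [NormedAddCommGroup V] (x : V) {q : ℝ} (hq : 0 ≤ q) :
    ‖x‖ₑ ^ q = ENNReal.ofReal (‖x‖ ^ q) := by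
  rw [← ofReal_norm, ENNReal.ofReal_rpow_of_nonneg (norm_nonneg _) hq]

section Flux

variable {V : Type*} [NormedAddCommGroup V] [InnerProductSpace ℝ V]
    [FiniteDimensional ℝ V] [MeasurableSpace V] [BorelSpace V]

lemma integrableOn_inner_of_continuousOn {A X : V → V} {K : Set V} (hK : IsCompact K)
    (hA : IntegrableOn A K) (hX : ContinuousOn X K) :
    IntegrableOn (fun x => ⟪A x, X x⟫) K := by
  obtain ⟨C, hC⟩ := hK.exists_bound_of_continuousOn hX
  refine Integrable.mono' (hA.norm.mul_const C)
    (hA.aestronglyMeasurable.inner (hX.aestronglyMeasurable hK.measurableSet)) ?_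
  filter_upwards [ae_restrict_mem hK.measurableSet] with x hx
  exact (norm_inner_le_norm _ _).trans (mul_le_mul_of_nonneg_left (hC x hx) (norm_nonneg _))

lemma setIntegral_test_eq {E B : Set V} (hE : IsOpen E) (hB : B ⊆ E) {φ : V → ℝ}
    (hφ : tsupport φ ⊆ B) (A : V → V) (g : V → ℝ) :
    (∫ x in E, ⟪A x, gradient φ x⟫ = ∫ x in B, ⟪A x, gradient φ x⟫) ∧
    (∫ x in E, g x * φ x = ∫ x in B, g x * φ x) := by
  constructor
  · refine setIntegral_eq_of_subset_of_forall_sdiff_eq_zero hE.measurableSet hB ?_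
    intro x hx
    rw [gradient, image_eq_zero_of_notMem_tsupport (f := fderiv ℝ φ)
      (fun h => hx.2 (hφ (tsupport_fderiv_subset ℝ h))), map_zero, inner_zero_right]
  · refine setIntegral_eq_of_subset_of_forall_sdiff_eq_zero hE.measurableSet hB ?_
    intro x hx
    rw [image_eq_zero_of_notMem_tsupport (fun h => hx.2 (hφ h)), mul_zero]

variable {E : Set V} {u : V → ℝ} {A : V → V} {g : V → ℝ} {p c C : ℝ} {z : V} {R : ℝ}

/-- Caccioppoli-type inequality. -/
lemma IsFluxSolution.energy_le (hs : IsFluxSolution E u A g p c C z R) {C₀ : ℝ} (hC₀ : 0 ≤ C₀)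
    {η : V → ℝ} {r : ℝ} (hr : 0 < r) (hrR : 2 * r ≤ R) (hη : ContDiff ℝ 1 η)
    (hη01 : ∀ x, 0 ≤ η x ∧ η x ≤ 1) (hη1 : ∀ x ∈ closedBall z r, η x = 1)
    (hηs : tsupport η ⊆ closedBall z (2 * r)) (hηg : ∀ x, ‖gradient η x‖ ≤ C₀ / r) (d : ℝ) :
    ENNReal.ofReal c * ∫⁻ x in closedBall z r, ‖gradient u x‖ₑ ^ p ≤
      ENNReal.ofReal (C * (C₀ + 1) / r) * ∫⁻ x in closedBall z (2 * r),
        (‖gradient u x‖ₑ ^ (p - 1) + ENNReal.ofReal r) * ‖u x - d‖ₑ := by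
  set B := closedBall z (2 * r) with hB
  have hBc : IsCompact B := isCompact_closedBall _ _
  have hBR : B ⊆ closedBall z R := closedBall_subset_closedBall hrR
  have hBE : B ⊆ E := hBR.trans hs.ball_subset
  have hp := hs.one_lt
  set φ : V → ℝ := fun x => η x * (u x - d) with hφ
  have hφs : tsupport φ ⊆ B := by
    refine (closure_mono ?_).trans hηs
    intro x hx
    exact left_ne_zero_of_mul hx
  have hφ1 : ContDiff ℝ 1 φ := by
    rw [contDiff_iff_contDiffAt]
    intro x
    by_cases hx : x ∈ E
    · exact hη.contDiffAt.mul
        ((hs.contDiffOn.contDiffAt (hs.isOpen.mem_nhds hx)).sub contDiffAt_const)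
    · have : φ =ᶠ[𝓝 x] fun _ => 0 :=
        notMem_tsupport_iff_eventuallyEq.1 fun h => hx (hBE (hφs h))
      exact contDiffAt_const.congr_of_eventuallyEq this
  have hφc : HasCompactSupport φ := hBc.of_isClosed_subset (isClosed_tsupport _) hφs
  have hw := hs.weak φ hφ1 hφc (hφs.trans hBE)
  obtain ⟨e1, e2⟩ := setIntegral_test_eq hs.isOpen hBE hφs A g
  rw [e1, e2] at hw
  have hgrad : ∀ x ∈ B, gradient φ x = η x • gradient u x + (u x - d) • gradient η x := by
    intro x hx
    have h1 := ((hη.differentiable one_ne_zero) x).hasFDerivAt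
    have h2 := ((hs.contDiffOn.contDiffAt (hs.isOpen.mem_nhds (hBE hx))).differentiableAt
      one_ne_zero).hasFDerivAt.sub_const d
    have h3 : fderiv ℝ φ x = _ := (h1.mul h2).fderiv
    simp only [gradient, h3, map_add, map_smul]
  have hucont : ContinuousOn u B := hs.contDiffOn.continuousOn.mono hBE
  have hgη := continuous_gradient_of_contDiff hη
  have hAB : IntegrableOn A B := hs.integrableOn_flux.mono_set hBR
  have hgB : IntegrableOn g B := hs.integrableOn_source.mono_set hBR
  have i1 : IntegrableOn (fun x => ⟪A x, gradient φ x⟫) B :=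
    integrableOn_inner_of_continuousOn hBc hAB (continuous_gradient_of_contDiff hφ1).continuousOn
  have i2 : IntegrableOn (fun x => ⟪A x, (u x - d) • gradient η x⟫) B :=
    integrableOn_inner_of_continuousOn hBc hAB
      ((hucont.sub continuousOn_const).smul hgη.continuousOn)
  have i3 : IntegrableOn (fun x => g x * φ x) B :=
    hgB.mul_continuousOn hφ1.continuous.continuousOn hBc
  set F : V → ℝ := fun x => ⟪A x, gradient φ x⟫ - ⟪A x, (u x - d) • gradient η x⟫ with hF
  have hFx : ∀ x ∈ B, F x = η x * ⟪A x, gradient u x⟫ := by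
    intro x hx
    simp only [hF, hgrad x hx, inner_add_right, inner_smul_right]
    ring
  have hFeq : ∫ x in B, F x = ∫ x in B, (g x * φ x - ⟪A x, (u x - d) • gradient η x⟫) := by
    rw [integral_sub i1 i2, integral_sub i3 i2, hw]
  have hcoer : ∀ x ∈ B, 0 ≤ ⟪A x, gradient u x⟫ := fun x hx =>
    le_trans (by have := hs.c_pos; positivity) (hs.coercive x (hBR hx))
  calc ENNReal.ofReal c * ∫⁻ x in closedBall z r, ‖gradient u x‖ₑ ^ p
      = ∫⁻ x in closedBall z r, ENNReal.ofReal (c * ‖gradient u x‖ ^ p) := by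
        rw [← lintegral_const_mul' _ _ ENNReal.ofReal_ne_top]
        congr 1; ext x
        rw [enorm_rpow_eq_ofReal _ (by linarith), ENNReal.ofReal_mul hs.c_pos.le]
    _ ≤ ∫⁻ x in closedBall z r, ENNReal.ofReal (F x) := by
        refine setLIntegral_mono' measurableSet_closedBall fun x hx => ENNReal.ofReal_le_ofReal ?_
        have hxB : x ∈ B := closedBall_subset_closedBall (by linarith) hx
        rw [hFx x hxB, hη1 x hx, one_mul]
        exact hs.coercive x (hBR hxB)
    _ ≤ ∫⁻ x in B, ENNReal.ofReal (F x) :=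
        lintegral_mono_set (closedBall_subset_closedBall (by linarith))
    _ = ENNReal.ofReal (∫ x in B, F x) := by
        refine (ofReal_integral_eq_lintegral_ofReal (i1.sub i2) ?_).symm
        filter_upwards [ae_restrict_mem hBc.measurableSet] with x hx
        have := hFx x hx
        simp only [hF] at this
        simp only [Pi.zero_apply, Pi.sub_apply, this]
        exact mul_nonneg (hη01 x).1 (hcoer x hx)
    _ ≤ ‖∫ x in B, (g x * φ x - ⟪A x, (u x - d) • gradient η x⟫)‖ₑ := by
        rw [hFeq, ← ofReal_norm]
        exact ENNReal.ofReal_le_ofReal (le_abs_self _)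
    _ ≤ ∫⁻ x in B, ‖g x * φ x - ⟪A x, (u x - d) • gradient η x⟫‖ₑ :=
        enorm_integral_le_lintegral_enorm _
    _ ≤ ∫⁻ x in B, ENNReal.ofReal (C * (C₀ + 1) / r) *
          ((‖gradient u x‖ₑ ^ (p - 1) + ENNReal.ofReal r) * ‖u x - d‖ₑ) := by
        refine setLIntegral_mono' hBc.measurableSet fun x hx => ?_
        have hC := hs.C_nonneg
        rw [enorm_rpow_eq_ofReal _ (by linarith), ← ENNReal.ofReal_add (by positivity) hr.le,
          ← ofReal_norm, ← ofReal_norm,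
          ← ENNReal.ofReal_mul (by positivity), ← ENNReal.ofReal_mul (by positivity)]
        refine ENNReal.ofReal_le_ofReal ?_
        set T := ‖gradient u x‖ ^ (p - 1) with hT
        have hT0 : 0 ≤ T := by positivity
        set w := ‖u x - d‖ with hw'
        have hw0 : 0 ≤ w := norm_nonneg _
        have a1 : ‖g x * φ x‖ ≤ C * w := by
          rw [norm_mul]
          refine mul_le_mul (hs.source_le x (hBR hx)) ?_ (norm_nonneg _) hC
          rw [hφ, norm_mul, Real.norm_of_nonneg (hη01 x).1]
          exact mul_le_of_le_one_left hw0 (hη01 x).2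
        have a2 : ‖⟪A x, (u x - d) • gradient η x⟫‖ ≤ (C * T) * (w * (C₀ / r)) := by
          refine (norm_inner_le_norm _ _).trans ?_
          rw [norm_smul]
          gcongr
          · exact hs.growth x (hBR hx)
          · exact hηg x
        refine (norm_sub_le _ _).trans ((add_le_add a1 a2).trans ?_)
        have : C * (C₀ + 1) / r * ((T + r) * w) =
            C * w + C * T * (w * (C₀ / r)) + C * w * (C₀ + T / r) := by
          field_simp; ring
        rw [this]
        have : 0 ≤ C * w * (C₀ + T / r) := by positivity
        linarith
    _ = _ := lintegral_const_mul' _ _ ENNReal.ofReal_ne_top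

/-- The source at the centre of a ball is controlled by the flux through the ball. -/
lemma IsFluxSolution.source_mul_volume_le (hs : IsFluxSolution E u A g p c C z R) {C₀ : ℝ}
    (hC₀ : 0 ≤ C₀) {η : V → ℝ} {r : ℝ} (hr : 0 < r) (hrR : 2 * r ≤ R) (hη : ContDiff ℝ 1 η)
    (hη01 : ∀ x, 0 ≤ η x ∧ η x ≤ 1) (hη1 : ∀ x ∈ closedBall z r, η x = 1)
    (hηs : tsupport η ⊆ closedBall z (2 * r)) (hηg : ∀ x, ‖gradient η x‖ ≤ C₀ / r) :
    ‖g z‖ₑ * volume (closedBall z r) ≤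
      ENNReal.ofReal (C * C₀ / r) * (∫⁻ x in closedBall z (2 * r), ‖gradient u x‖ₑ ^ (p - 1)) +
        ∫⁻ x in closedBall z (2 * r), ‖g x - g z‖ₑ := by
  set B := closedBall z (2 * r) with hB
  have hBc : IsCompact B := isCompact_closedBall _ _
  have hBR : B ⊆ closedBall z R := closedBall_subset_closedBall hrR
  have hBE : B ⊆ E := hBR.trans hs.ball_subset
  have hp := hs.one_lt
  have hηc : HasCompactSupport η := hBc.of_isClosed_subset (isClosed_tsupport _) hηs
  have hw := hs.weak η hη hηc (hηs.trans hBE)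
  obtain ⟨e1, e2⟩ := setIntegral_test_eq hs.isOpen hBE hηs A g
  rw [e1, e2] at hw
  have hgB : IntegrableOn g B := hs.integrableOn_source.mono_set hBR
  have hconst : IntegrableOn (fun _ : V => g z) B :=
    integrableOn_const hBc.measure_lt_top.ne
  have i1 : IntegrableOn (fun x => g x * η x) B :=
    hgB.mul_continuousOn hη.continuous.continuousOn hBc
  have i2 : IntegrableOn (fun x => (g x - g z) * η x) B :=
    (hgB.sub hconst).mul_continuousOn hη.continuous.continuousOn hBc
  have i3 : IntegrableOn η B := hη.continuous.continuousOn.integrableOn_compact hBc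
  have hvol : volume (closedBall z r) ≤ ‖∫ x in B, η x‖ₑ := by
    have hint : 0 ≤ ∫ x in B, η x := integral_nonneg fun x => (hη01 x).1
    rw [← ofReal_norm, Real.norm_of_nonneg hint,
      ofReal_integral_eq_lintegral_ofReal i3 (Filter.Eventually.of_forall fun x => (hη01 x).1)]
    calc volume (closedBall z r) = ∫⁻ x in closedBall z r, 1 := by simp
      _ ≤ ∫⁻ x in closedBall z r, ENNReal.ofReal (η x) := by
          refine setLIntegral_mono' measurableSet_closedBall fun x hx => ?_
          rw [hη1 x hx, ENNReal.ofReal_one]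
      _ ≤ _ := lintegral_mono_set (closedBall_subset_closedBall (by linarith))
  have hsplit : g z * ∫ x in B, η x =
      (∫ x in B, ⟪A x, gradient η x⟫) - ∫ x in B, (g x - g z) * η x := by
    rw [hw, ← integral_sub i1 i2, ← integral_const_mul]
    congr 1; ext x; ring
  calc ‖g z‖ₑ * volume (closedBall z r) ≤ ‖g z * ∫ x in B, η x‖ₑ := by
        rw [enorm_mul]; gcongr
    _ ≤ ‖∫ x in B, ⟪A x, gradient η x⟫‖ₑ + ‖∫ x in B, (g x - g z) * η x‖ₑ := by
        rw [hsplit]; exact enorm_sub_le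
    _ ≤ (∫⁻ x in B, ‖⟪A x, gradient η x⟫‖ₑ) + ∫⁻ x in B, ‖(g x - g z) * η x‖ₑ :=
        add_le_add (enorm_integral_le_lintegral_enorm _) (enorm_integral_le_lintegral_enorm _)
    _ ≤ _ := by
        rw [← lintegral_const_mul' _ _ ENNReal.ofReal_ne_top]
        refine add_le_add (setLIntegral_mono' hBc.measurableSet fun x hx => ?_)
          (lintegral_mono fun x => ?_)
        · have hC := hs.C_nonneg
          rw [enorm_rpow_eq_ofReal _ (by linarith), ← ofReal_norm,
            ← ENNReal.ofReal_mul (by positivity)]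
          refine ENNReal.ofReal_le_ofReal ((norm_inner_le_norm _ _).trans ?_)
          calc ‖A x‖ * ‖gradient η x‖ ≤ (C * ‖gradient u x‖ ^ (p - 1)) * (C₀ / r) := by
                gcongr
                · exact hs.growth x (hBR hx)
                · exact hηg x
            _ = _ := by ring
        · rw [enorm_mul]
          refine mul_le_of_le_one_right' ?_
          rw [← ofReal_norm, Real.norm_of_nonneg (hη01 x).1]
          exact ENNReal.ofReal_le_one.2 (hη01 x).2

/-- Decay estimate for the energy at one scale, in terms of the measure of the set where the
gradient does not vanish. -/
lemma IsFluxSolution.energy_le_of_support (hs : IsFluxSolution E u A g p c C z R) :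
    ∃ K : ℝ, 0 ≤ K ∧ ∀ (r ℓ : ℝ) (κ : ℝ≥0∞), 0 < r → 3 * r ≤ R → 0 < ℓ → ℓ ≤ 1 → κ ≠ 0 → κ ≠ ∞ →
      ENNReal.ofReal c * ∫⁻ x in closedBall z r, ‖gradient u x‖ₑ ^ p ≤
      ENNReal.ofReal (K / r) *
        (ENNReal.ofReal (ℓ * r) * (3 * (∫⁻ x in closedBall z (3 * r), ‖gradient u x‖ₑ ^ p) +
          volume (closedBall z (2 * r)) * (ENNReal.ofReal r ^ (1 / (p - 1))) ^ p) +
        ENNReal.ofReal (2 * r) *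
          (2 * volume (closedBall z (3 * r) ∩ {x | gradient u x ≠ 0}) *
              (∫⁻ x in closedBall z (3 * r), ‖gradient u x‖ₑ ^ p) +
            volume (closedBall z (2 * r)) *
              (κ ^ (p - 1) * (∫⁻ x in closedBall z (3 * r), ‖gradient u x‖ₑ ^ p) +
              κ⁻¹ * (ENNReal.ofReal r ^ (1 / (p - 1))) ^ p *
                volume (closedBall z (3 * r) ∩ {x | gradient u x ≠ 0}))) /
          volume (closedBall (0 : V) (ℓ * r))) := by
  obtain ⟨C₀, hC₀, hcut⟩ := exists_cutoff V
  have hC := hs.C_nonneg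
  refine ⟨C * (C₀ + 1), by positivity, fun r ℓ κ hr hrR hℓ hℓ1 h0 ht => ?_⟩
  obtain ⟨η, hη, hη01, hη1, hηs, hηg⟩ := hcut z r hr
  have hp := hs.one_lt
  set β := ENNReal.ofReal r ^ (1 / (p - 1)) with hβ
  have hβ1 : β ^ (p - 1) = ENNReal.ofReal r := by
    rw [hβ, ← ENNReal.rpow_mul, one_div_mul_cancel (by linarith), ENNReal.rpow_one]
  set B3 := closedBall z (3 * r) with hB3
  have hB3E : B3 ⊆ E := (closedBall_subset_closedBall hrR).trans hs.ball_subset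
  have hGc : ContinuousOn (gradient u) B3 :=
    (continuousOn_gradient_of_contDiffOn hs.isOpen hs.contDiffOn).mono hB3E
  set h : V → ℝ≥0∞ := B3.indicator fun x => ‖gradient u x‖ₑ with hh
  have hmeas : Measurable h := by
    have : h = B3.piecewise (fun x => ‖gradient u x‖ₑ) (fun _ => 0) := by
      rw [hh, ← Set.piecewise_eq_indicator]; rfl
    rw [this]
    exact ContinuousOn.measurable_piecewise hGc.enorm continuousOn_const measurableSet_closedBall
  have hin : ∀ x ∈ B3, h x = ‖gradient u x‖ₑ := fun x hx => indicator_of_mem hx _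
  have hsupp : Function.support h = B3 ∩ {x | gradient u x ≠ 0} := by
    ext x
    by_cases hx : x ∈ B3
    · simp [hin x hx, hx]
    · simp [hh, hx]
  have hΦ : ∫⁻ x, h x ^ p = ∫⁻ x in B3, ‖gradient u x‖ₑ ^ p := by
    rw [← lintegral_indicator measurableSet_closedBall]
    congr 1; ext x
    by_cases hx : x ∈ B3
    · rw [hin x hx, indicator_of_mem hx]
    · rw [indicator_of_notMem hx, hh, indicator_of_notMem hx,
        ENNReal.zero_rpow_of_pos (by linarith)]
  have hS : MeasurableSet (Function.support h) := measurableSet_support hmeas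
  have hYpos : volume (closedBall (0 : V) (ℓ * r)) ≠ 0 :=
    (measure_closedBall_pos _ _ (by positivity)).ne'
  obtain ⟨y, hy, hle⟩ := exists_oscillation_le (μ := volume) hp hmeas hS
    (fun x hx => Function.notMem_support.1 hx) (D := closedBall z (2 * r)) hYpos
    measure_closedBall_lt_top.ne z (ENNReal.ofReal (ℓ * r)) (ENNReal.ofReal (2 * r)) β κ h0 ht
  rw [hΦ, hsupp] at hle
  refine (hs.energy_le hC₀ hr (by linarith) hη hη01 hη1 hηs hηg (u (z + y))).trans ?_
  refine mul_le_mul_right (le_trans ?_ hle) _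
  refine setLIntegral_mono' measurableSet_closedBall fun x hx => ?_
  have hyn : ‖y‖ ≤ ℓ * r := mem_closedBall_zero_iff.1 hy
  have hxn : ‖x - z‖ ≤ 2 * r := by rwa [mem_closedBall, dist_eq_norm] at hx
  have hℓr : ℓ * r ≤ r := mul_le_of_le_one_left hr.le hℓ1
  have tn : ∀ t ∈ Icc (0 : ℝ) 1, ∀ v : V, ‖t • v‖ ≤ ‖v‖ := fun t ht v => by
    rw [norm_smul, Real.norm_of_nonneg ht.1]
    exact mul_le_of_le_one_left (norm_nonneg _) ht.2
  have s1 : ∀ t ∈ Icc (0 : ℝ) 1, x + t • y ∈ B3 := fun t ht => by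
    rw [hB3, mem_closedBall, dist_eq_norm, show x + t • y - z = (x - z) + t • y by abel]
    linarith [norm_add_le (x - z) (t • y), tn t ht y]
  have s2 : ∀ t ∈ Icc (0 : ℝ) 1, z + y + t • (x - z) ∈ B3 := fun t ht => by
    rw [hB3, mem_closedBall, dist_eq_norm,
      show z + y + t • (x - z) - z = y + t • (x - z) by abel]
    linarith [norm_add_le y (t • (x - z)), tn t ht (x - z)]
  have b1 := enorm_sub_le_lintegral_gradient hs.isOpen hs.contDiffOn (x := x) (v := y)
    fun t ht => hB3E (s1 t ht)
  have b2 := enorm_sub_le_lintegral_gradient hs.isOpen hs.contDiffOn (x := z + y) (v := x - z)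
    fun t ht => hB3E (s2 t ht)
  rw [show z + y + (x - z) = x + y by abel] at b2
  have c1 : ∫⁻ t in Icc (0 : ℝ) 1, ‖gradient u (x + t • y)‖ₑ =
      ∫⁻ t in Icc (0 : ℝ) 1, h (x + t • y) :=
    setLIntegral_congr_fun measurableSet_Icc fun t ht => (hin _ (s1 t ht)).symm
  have c2 : ∫⁻ t in Icc (0 : ℝ) 1, ‖gradient u (z + y + t • (x - z))‖ₑ =
      ∫⁻ t in Icc (0 : ℝ) 1, h (z + y + t • (x - z)) :=
    setLIntegral_congr_fun measurableSet_Icc fun t ht => (hin _ (s2 t ht)).symm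
  rw [c1] at b1
  rw [c2] at b2
  have hx3 : x ∈ B3 := closedBall_subset_closedBall (by linarith) hx
  rw [hin x hx3, hβ1]
  refine mul_le_mul_right ?_ _
  calc ‖u x - u (z + y)‖ₑ = ‖(u (x + y) - u (z + y)) - (u (x + y) - u x)‖ₑ := by congr 1; ring
    _ ≤ ‖u (x + y) - u (z + y)‖ₑ + ‖u (x + y) - u x‖ₑ := enorm_sub_le
    _ ≤ _ := by
      rw [add_comm]
      refine add_le_add (b1.trans ?_) (b2.trans ?_)
      · gcongr
        rw [← ofReal_norm]
        exact ENNReal.ofReal_le_ofReal hyn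
      · gcongr
        rw [← ofReal_norm]
        exact ENNReal.ofReal_le_ofReal hxn

/-- If `z` is a density point of the critical set, the energy decays faster than any multiple
of its natural scaling. -/
lemma IsFluxSolution.eventually_energy_le (hs : IsFluxSolution E u A g p c C z R)
    (hdens : Filter.Tendsto (fun ρ => volume (closedBall z ρ ∩ {x | gradient u x ≠ 0}) /
      volume (closedBall z ρ)) (𝓝[>] 0) (𝓝 0)) {θ : ℝ≥0∞} (hθ : θ ≠ 0) :
    ∀ᶠ r in 𝓝[>] (0 : ℝ), ∫⁻ x in closedBall z r, ‖gradient u x‖ₑ ^ p ≤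
      θ * ((∫⁻ x in closedBall z (3 * r), ‖gradient u x‖ₑ ^ p) +
        volume (closedBall z (3 * r)) * (ENNReal.ofReal r ^ (1 / (p - 1))) ^ p) := by
  wlog hθt : θ ≠ ∞ generalizing θ
  · filter_upwards [this one_ne_zero ENNReal.one_ne_top] with r hr
    refine hr.trans (mul_le_mul_left ?_ _)
    rw [not_not.1 hθt]; exact le_top
  obtain ⟨K, hK, hest⟩ := hs.energy_le_of_support
  have hp := hs.one_lt
  have hR := hs.R_pos
  set c' := ENNReal.ofReal c with hc'
  have hc0 : c' ≠ 0 := by simpa [hc'] using hs.c_pos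
  have hct : c' ≠ ∞ := ENNReal.ofReal_ne_top
  set K' := ENNReal.ofReal K with hK'
  have hKt : K' ≠ ∞ := ENNReal.ofReal_ne_top
  set τ := θ * c' / (3 * (K' + 1)) with hτ
  have hden0 : 3 * (K' + 1) ≠ 0 := by simp
  have hdent : 3 * (K' + 1) ≠ ∞ := by finiteness
  have hτ0 : τ ≠ 0 := ENNReal.div_ne_zero.2 ⟨mul_ne_zero hθ hc0, hdent⟩
  have hτt : τ ≠ ∞ := ENNReal.div_ne_top (by finiteness) hden0
  have hτθ : K' * (3 * τ) ≤ θ * c' := by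
    calc K' * (3 * τ) ≤ (K' + 1) * (3 * τ) := by gcongr; exact le_self_add
      _ = 3 * (K' + 1) * τ := by ring
      _ = θ * c' := by rw [hτ, ENNReal.mul_div_cancel hden0 hdent]
  set ℓ : ℝ := min 1 (τ.toReal / 3) with hℓ
  have hτpos : 0 < τ.toReal := ENNReal.toReal_pos hτ0 hτt
  have hℓ0 : 0 < ℓ := by positivity
  have hℓ1 : ℓ ≤ 1 := min_le_left _ _
  have hℓτ : 3 * ENNReal.ofReal ℓ ≤ τ := by
    rw [← ENNReal.ofReal_toReal hτt, show (3 : ℝ≥0∞) = ENNReal.ofReal 3 by simp,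
      ← ENNReal.ofReal_mul (by norm_num)]
    refine ENNReal.ofReal_le_ofReal ?_
    linarith [min_le_right 1 (τ.toReal / 3)]
  set M := ENNReal.ofReal ((3 / ℓ) ^ Module.finrank ℝ V) with hM
  have hM0 : M ≠ 0 := by simp only [hM, ne_eq, ENNReal.ofReal_eq_zero, not_le]; positivity
  have hMt : M ≠ ∞ := ENNReal.ofReal_ne_top
  have h2M0 : 2 * M ≠ 0 := by simp [hM0]
  have h2Mt : 2 * M ≠ ∞ := by finiteness
  set κ := (τ / (2 * M)) ^ (1 / (p - 1)) with hκ
  have hp' : 0 < 1 / (p - 1) := one_div_pos.2 (by linarith)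
  have hq0 : τ / (2 * M) ≠ 0 := ENNReal.div_ne_zero.2 ⟨hτ0, h2Mt⟩
  have hqt : τ / (2 * M) ≠ ∞ := ENNReal.div_ne_top hτt h2M0
  have hκ0 : κ ≠ 0 := by
    simp only [hκ, ne_eq, ENNReal.rpow_eq_zero_iff]; tauto_set
  have hκt : κ ≠ ∞ := ENNReal.rpow_ne_top_of_nonneg hp'.le hqt
  have hκτ : 2 * M * κ ^ (p - 1) = τ := by
    rw [hκ, ← ENNReal.rpow_mul, one_div_mul_cancel (by linarith), ENNReal.rpow_one,
      ENNReal.mul_div_cancel h2M0 h2Mt]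
  set N := 2 * M * (2 + κ⁻¹) with hN
  have hN0 : N ≠ 0 := mul_ne_zero h2M0 (by simp)
  have hNt : N ≠ ∞ := by
    have : κ⁻¹ ≠ ∞ := ENNReal.inv_ne_top.2 hκ0
    finiteness
  set ε := τ / N with hε
  have hε0 : ε ≠ 0 := ENNReal.div_ne_zero.2 ⟨hτ0, hNt⟩
  have hετ : N * ε = τ := ENNReal.mul_div_cancel hN0 hNt
  have h3 : Filter.Tendsto (fun r : ℝ => 3 * r) (𝓝[>] 0) (𝓝[>] 0) := by
    refine tendsto_nhdsWithin_iff.2 ⟨?_, ?_⟩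
    · have : Filter.Tendsto (fun r : ℝ => 3 * r) (𝓝 0) (𝓝 (3 * 0)) :=
        (continuous_const.mul continuous_id).tendsto 0
      rw [mul_zero] at this
      exact this.mono_left nhdsWithin_le_nhds
    · filter_upwards [self_mem_nhdsWithin] with r (hr : 0 < r)
      exact mem_Ioi.2 (by positivity)
  have hsmall := (hdens.comp h3).eventually (ge_mem_nhds (pos_iff_ne_zero.2 hε0))
  filter_upwards [hsmall, self_mem_nhdsWithin,
    Ioo_mem_nhdsGT (show (0 : ℝ) < R / 3 by positivity)] with r hr (hr0 : 0 < r) hrR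
  have hr3 : 3 * r ≤ R := by linarith [hrR.2]
  have hmain := hest r ℓ κ hr0 hr3 hℓ0 hℓ1 hκ0 hκt
  set Φ := ∫⁻ x in closedBall z (3 * r), ‖gradient u x‖ₑ ^ p with hΦ
  set b := (ENNReal.ofReal r ^ (1 / (p - 1))) ^ p with hb
  set W := volume (closedBall z (3 * r)) with hW
  set σ := volume (closedBall z (3 * r) ∩ {x | gradient u x ≠ 0}) with hσ
  set Y := volume (closedBall (0 : V) (ℓ * r)) with hY
  have hW0 : W ≠ 0 := (measure_closedBall_pos _ _ (by positivity)).ne'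
  have hWt : W ≠ ∞ := measure_closedBall_lt_top.ne
  have hY0 : Y ≠ 0 := (measure_closedBall_pos _ _ (by positivity)).ne'
  have hYt : Y ≠ ∞ := measure_closedBall_lt_top.ne
  have hσW : σ ≤ ε * W := (ENNReal.div_le_iff hW0 hWt).1 hr
  have h2W : volume (closedBall z (2 * r)) ≤ W :=
    measure_mono (closedBall_subset_closedBall (by linarith))
  have hWY : W = M * Y := by
    rw [hW, hY, Measure.addHaar_closedBall _ _ (by positivity),
      Measure.addHaar_closedBall _ _ (by positivity), ← mul_assoc, hM,
      ← ENNReal.ofReal_mul (by positivity)]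
    congr 2
    rw [← mul_pow]; congr 1; field_simp
  refine (ENNReal.mul_le_mul_iff_right hc0 hct).1 (hmain.trans ?_)
  have hKr : ∀ s : ℝ, 0 ≤ s → ENNReal.ofReal (K / r) * ENNReal.ofReal (s * r) =
      K' * ENNReal.ofReal s := by
    intro s hs0
    rw [hK', ← ENNReal.ofReal_mul (by positivity), ← ENNReal.ofReal_mul hK]
    congr 1; field_simp
  have first : 3 * Φ + volume (closedBall z (2 * r)) * b ≤ 3 * (Φ + W * b) := by
    calc 3 * Φ + volume (closedBall z (2 * r)) * b ≤ 3 * Φ + 3 * (W * b) := by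
          refine add_le_add le_rfl ?_
          calc volume (closedBall z (2 * r)) * b ≤ 1 * (W * b) := by rw [one_mul]; gcongr
            _ ≤ 3 * (W * b) := mul_le_mul_left (by norm_num) _
      _ = _ := by ring
  have second : (2 * σ * Φ + volume (closedBall z (2 * r)) * (κ ^ (p - 1) * Φ + κ⁻¹ * b * σ)) / Y
      ≤ M * ((2 + κ⁻¹) * ε + κ ^ (p - 1)) * (Φ + W * b) := by
    refine ENNReal.div_le_of_le_mul ?_
    calc 2 * σ * Φ + volume (closedBall z (2 * r)) * (κ ^ (p - 1) * Φ + κ⁻¹ * b * σ)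
        ≤ 2 * (ε * W) * Φ + W * (κ ^ (p - 1) * Φ + κ⁻¹ * b * (ε * W)) := by gcongr
      _ = W * ((2 * ε + κ ^ (p - 1)) * Φ + κ⁻¹ * ε * (W * b)) := by ring
      _ ≤ W * (((2 + κ⁻¹) * ε + κ ^ (p - 1)) * Φ +
            ((2 + κ⁻¹) * ε + κ ^ (p - 1)) * (W * b)) := by
          gcongr
          · exact le_self_add
          · calc κ⁻¹ * ε ≤ (2 + κ⁻¹) * ε := by gcongr; exact le_add_self
              _ ≤ _ := le_self_add
      _ = _ := by rw [← mul_add]; nth_rewrite 1 [hWY]; ring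
  calc ENNReal.ofReal (K / r) * (ENNReal.ofReal (ℓ * r) *
        (3 * Φ + volume (closedBall z (2 * r)) * b) + ENNReal.ofReal (2 * r) *
        (2 * σ * Φ + volume (closedBall z (2 * r)) * (κ ^ (p - 1) * Φ + κ⁻¹ * b * σ)) / Y)
      = K' * ENNReal.ofReal ℓ * (3 * Φ + volume (closedBall z (2 * r)) * b) +
        K' * ENNReal.ofReal 2 * ((2 * σ * Φ + volume (closedBall z (2 * r)) *
          (κ ^ (p - 1) * Φ + κ⁻¹ * b * σ)) / Y) := by
        rw [mul_add, mul_div_assoc, ← mul_assoc, ← mul_assoc, hKr ℓ hℓ0.le, hKr 2 zero_le_two]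
    _ ≤ K' * ENNReal.ofReal ℓ * (3 * (Φ + W * b)) +
        K' * ENNReal.ofReal 2 * (M * ((2 + κ⁻¹) * ε + κ ^ (p - 1)) * (Φ + W * b)) := by
        gcongr
    _ = K' * (3 * ENNReal.ofReal ℓ + N * ε + 2 * M * κ ^ (p - 1)) * (Φ + W * b) := by
        rw [hN, show ENNReal.ofReal 2 = 2 by simp]; ring
    _ ≤ K' * (τ + τ + τ) * (Φ + W * b) := by rw [hετ, hκτ]; gcongr
    _ = K' * (3 * τ) * (Φ + W * b) := by ring
    _ ≤ θ * c' * (Φ + W * b) := by gcongr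
    _ = c' * (θ * (Φ + W * b)) := by ring

/-- If `f` contracts by an arbitrarily small factor under dilation by `3`, up to an error of the
same size, then `f` is arbitrarily small at arbitrarily small radii. -/
lemma frequently_le_of_forall_eventually_le_dilation {f : ℝ → ℝ≥0∞}
    (hfin : ∀ᶠ r in 𝓝[>] (0 : ℝ), f r ≠ ∞)
    (h : ∀ θ : ℝ≥0∞, θ ≠ 0 → ∀ᶠ r in 𝓝[>] (0 : ℝ), f r ≤ θ * (f (3 * r) + 1)) {δ : ℝ≥0∞}
    (hδ : δ ≠ 0) : ∃ᶠ r in 𝓝[>] (0 : ℝ), f r ≤ δ := by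
  intro hcon
  set θ := 2⁻¹ / (1 + δ⁻¹) with hθ
  have hd : 1 + δ⁻¹ ≠ ∞ := by
    have : δ⁻¹ ≠ ∞ := ENNReal.inv_ne_top.2 hδ
    finiteness
  have hθ0 : θ ≠ 0 := ENNReal.div_ne_zero.2 ⟨by simp, hd⟩
  obtain ⟨ρ, hρ, hsub⟩ := mem_nhdsGT_iff_exists_Ioc_subset.1 (hcon.and (hfin.and (h θ hθ0)))
  have hρ' : (0 : ℝ) < ρ := hρ
  have step : ∀ r, 0 < r → 3 * r ≤ ρ → f r ≤ 2⁻¹ * f (3 * r) := by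
    intro r hr hr3
    have h3 : δ < f (3 * r) := not_le.1 (hsub ⟨by positivity, hr3⟩).1
    have h1 : 1 ≤ δ⁻¹ * f (3 * r) := by
      rw [← ENNReal.inv_mul_cancel hδ h3.ne_top]
      gcongr
    calc f r ≤ θ * (f (3 * r) + 1) := (hsub ⟨hr, by linarith⟩).2.2
      _ ≤ θ * (f (3 * r) + δ⁻¹ * f (3 * r)) := by gcongr
      _ = (1 + δ⁻¹) * θ * f (3 * r) := by ring
      _ = 2⁻¹ * f (3 * r) := by rw [hθ, ENNReal.mul_div_cancel (by simp) hd]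
  have iter : ∀ k : ℕ, f (ρ / 3 ^ k) ≤ 2⁻¹ ^ k * f ρ := by
    intro k
    induction k with
    | zero => simp
    | succ k ih =>
      have e : 3 * (ρ / 3 ^ (k + 1)) = ρ / 3 ^ k := by rw [pow_succ]; field_simp
      have hle : ρ / 3 ^ k ≤ ρ := div_le_self hρ'.le (one_le_pow₀ (by norm_num))
      have := step (ρ / 3 ^ (k + 1)) (by positivity) (e ▸ hle)
      rw [e] at this
      calc f (ρ / 3 ^ (k + 1)) ≤ 2⁻¹ * f (ρ / 3 ^ k) := this
        _ ≤ 2⁻¹ * (2⁻¹ ^ k * f ρ) := by gcongr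
        _ = _ := by ring
  have lim : Filter.Tendsto (fun k : ℕ => (2⁻¹ : ℝ≥0∞) ^ k * f ρ) Filter.atTop (𝓝 0) := by
    have := ENNReal.Tendsto.mul_const
      (ENNReal.tendsto_pow_atTop_nhds_zero_of_lt_one (r := 2⁻¹) (by simp))
      (Or.inr (hsub ⟨hρ', le_rfl⟩).2.1)
    rwa [zero_mul] at this
  obtain ⟨k, hk⟩ := (lim.eventually (ge_mem_nhds (pos_iff_ne_zero.2 hδ))).exists
  have hle : ρ / 3 ^ k ≤ ρ := div_le_self hρ'.le (one_le_pow₀ (by norm_num))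
  exact (hsub ⟨by positivity, hle⟩).1 ((iter k).trans hk)

/-- At a density point of the critical set, the normalised energy is small at arbitrarily small
radii. -/
lemma IsFluxSolution.frequently_energy_le (hs : IsFluxSolution E u A g p c C z R)
    (hdens : Filter.Tendsto (fun ρ => volume (closedBall z ρ ∩ {x | gradient u x ≠ 0}) /
      volume (closedBall z ρ)) (𝓝[>] 0) (𝓝 0)) {δ : ℝ≥0∞} (hδ : δ ≠ 0) :
    ∃ᶠ r in 𝓝[>] (0 : ℝ), ∫⁻ x in closedBall z r, ‖gradient u x‖ₑ ^ p ≤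
      δ * (volume (closedBall z r) * (ENNReal.ofReal r ^ (1 / (p - 1))) ^ p) := by
  have hp := hs.one_lt
  have hp' : 0 < 1 / (p - 1) := one_div_pos.2 (by linarith)
  set Φ : ℝ → ℝ≥0∞ := fun r => ∫⁻ x in closedBall z r, ‖gradient u x‖ₑ ^ p with hΦ
  set S : ℝ → ℝ≥0∞ := fun r => volume (closedBall z r) * (ENNReal.ofReal r ^ (1 / (p - 1))) ^ p
    with hS
  have hS0 : ∀ r, 0 < r → S r ≠ 0 := by
    intro r hr
    refine mul_ne_zero (measure_closedBall_pos _ _ hr).ne' ?_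
    have h1 : ENNReal.ofReal r ≠ 0 := by simpa using hr
    exact (ENNReal.rpow_pos (ENNReal.rpow_pos (pos_iff_ne_zero.2 h1) (by finiteness))
      (ENNReal.rpow_ne_top_of_nonneg hp'.le (by finiteness))).ne'
  have hSt : ∀ r, S r ≠ ∞ := fun r =>
    ENNReal.mul_ne_top measure_closedBall_lt_top.ne (ENNReal.rpow_ne_top_of_nonneg (by linarith)
      (ENNReal.rpow_ne_top_of_nonneg hp'.le (by finiteness)))
  set K : ℝ≥0∞ := ENNReal.ofReal (3 ^ Module.finrank ℝ V) *
    (ENNReal.ofReal 3 ^ (1 / (p - 1))) ^ p with hK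
  have hKt : K ≠ ∞ :=
    ENNReal.mul_ne_top (by finiteness) (ENNReal.rpow_ne_top_of_nonneg (by linarith)
      (ENNReal.rpow_ne_top_of_nonneg hp'.le (by finiteness)))
  have hSK : ∀ r, 0 < r → S (3 * r) = K * S r := by
    intro r hr
    simp only [hS, hK]
    rw [Measure.addHaar_closedBall _ _ (by positivity), Measure.addHaar_closedBall _ _ hr.le,
      mul_pow, ENNReal.ofReal_mul (by positivity), ENNReal.ofReal_mul (by positivity),
      ENNReal.mul_rpow_of_nonneg _ _ hp'.le, ENNReal.mul_rpow_of_nonneg _ _ (by linarith)]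
    ring
  have hfin : ∀ᶠ r in 𝓝[>] (0 : ℝ), Φ r / S r ≠ ∞ := by
    filter_upwards [self_mem_nhdsWithin, Ioo_mem_nhdsGT hs.R_pos] with r (hr : 0 < r) hrR
    refine ENNReal.div_ne_top ?_ (hS0 r hr)
    have hc : ContinuousOn (gradient u) (closedBall z r) :=
      (continuousOn_gradient_of_contDiffOn hs.isOpen hs.contDiffOn).mono
        ((closedBall_subset_closedBall hrR.2.le).trans hs.ball_subset)
    obtain ⟨M, hM⟩ := (isCompact_closedBall z r).exists_bound_of_continuousOn hc
    refine ne_top_of_le_ne_top (b := ENNReal.ofReal M ^ p * volume (closedBall z r))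
      (ENNReal.mul_ne_top (ENNReal.rpow_ne_top_of_nonneg (by linarith) (by finiteness))
        measure_closedBall_lt_top.ne) ?_
    rw [← setLIntegral_const]
    refine setLIntegral_mono' measurableSet_closedBall fun x hx => ?_
    refine ENNReal.rpow_le_rpow ?_ (by linarith)
    rw [← ofReal_norm]
    exact ENNReal.ofReal_le_ofReal (hM x hx)
  have hcontr : ∀ θ : ℝ≥0∞, θ ≠ 0 → ∀ᶠ r in 𝓝[>] (0 : ℝ),
      Φ r / S r ≤ θ * (Φ (3 * r) / S (3 * r) + 1) := by
    intro θ hθ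
    have hθK : θ / K ≠ 0 := ENNReal.div_ne_zero.2 ⟨hθ, hKt⟩
    filter_upwards [hs.eventually_energy_le hdens hθK, self_mem_nhdsWithin] with r hr (hr0 : 0 < r)
    refine ENNReal.div_le_of_le_mul (hr.trans ?_)
    have h3 : 0 < 3 * r := by positivity
    have e1 : Φ (3 * r) = Φ (3 * r) / S (3 * r) * S (3 * r) :=
      (ENNReal.div_mul_cancel (hS0 _ h3) (hSt _)).symm
    have e2 : volume (closedBall z (3 * r)) * (ENNReal.ofReal r ^ (1 / (p - 1))) ^ p ≤
        S (3 * r) := by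
      simp only [hS]
      gcongr
      linarith
    calc θ / K * (Φ (3 * r) +
          volume (closedBall z (3 * r)) * (ENNReal.ofReal r ^ (1 / (p - 1))) ^ p)
        ≤ θ / K * (Φ (3 * r) / S (3 * r) * S (3 * r) + S (3 * r)) := by
          rw [← e1]; gcongr
      _ = θ / K * K * ((Φ (3 * r) / S (3 * r) + 1) * S r) := by rw [hSK r hr0]; ring
      _ ≤ θ * ((Φ (3 * r) / S (3 * r) + 1) * S r) := by
          gcongr; rw [mul_comm]; exact ENNReal.mul_div_le
      _ = _ := by ring
  have := frequently_le_of_forall_eventually_le_dilation hfin hcontr hδ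
  refine (this.and_eventually self_mem_nhdsWithin).mono fun r hr => ?_
  exact (ENNReal.div_le_iff (hS0 r hr.2) (hSt r)).1 hr.1

/-- The source vanishes at every Lebesgue point which is a density point of the critical set. -/
lemma IsFluxSolution.source_eq_zero (hs : IsFluxSolution E u A g p c C z R)
    (hdens : Filter.Tendsto (fun ρ => volume (closedBall z ρ ∩ {x | gradient u x ≠ 0}) /
      volume (closedBall z ρ)) (𝓝[>] 0) (𝓝 0))
    (hleb : Filter.Tendsto (fun ρ => (∫⁻ x in closedBall z ρ, ‖g x - g z‖ₑ) /
      volume (closedBall z ρ)) (𝓝[>] 0) (𝓝 0)) : g z = 0 := by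
  obtain ⟨C₀, hC₀, hcut⟩ := exists_cutoff V
  have hC := hs.C_nonneg
  have hp := hs.one_lt
  have hp' : 0 < 1 / (p - 1) := one_div_pos.2 (by linarith)
  set D : ℝ≥0∞ := ENNReal.ofReal (2 ^ Module.finrank ℝ V) with hD
  set M : ℝ≥0∞ := ENNReal.ofReal (2 * C * C₀) with hM
  have hKt : D * (M * 2 + 1) ≠ ∞ := by finiteness
  have key : ∀ s : ℝ≥0∞, s ≠ 0 → s ≠ ∞ → ‖g z‖ₑ ≤ s * (D * (M * 2 + 1)) := by
    intro s hs0 hst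
    set κ := s ^ (1 / (p - 1)) with hκ
    have hκ0 : κ ≠ 0 := (ENNReal.rpow_pos (pos_iff_ne_zero.2 hs0) hst).ne'
    have hκt : κ ≠ ∞ := ENNReal.rpow_ne_top_of_nonneg hp'.le hst
    have hκs : κ ^ (p - 1) = s := by
      rw [hκ, ← ENNReal.rpow_mul, one_div_mul_cancel (by linarith), ENNReal.rpow_one]
    have hev := hleb.eventually (ge_mem_nhds (pos_iff_ne_zero.2 hs0))
    obtain ⟨r, hen, hlr, hr, hrR⟩ := ((hs.frequently_energy_le hdens
      (mul_ne_zero hκ0 hs0)).and_eventually (hev.and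
        (Ioo_mem_nhdsGT hs.R_pos))).exists
    replace hr : 0 < r := hr
    obtain ⟨η, hη, hη01, hη1, hηs, hηg⟩ := hcut z (r / 2) (by positivity)
    have hmain := hs.source_mul_volume_le hC₀ (r := r / 2) (by positivity)
      (by linarith) hη hη01 hη1 hηs hηg
    rw [show 2 * (r / 2) = r by ring] at hmain
    set W := volume (closedBall z r) with hW
    set W' := volume (closedBall z (r / 2)) with hW'
    have hW0 : W ≠ 0 := (measure_closedBall_pos _ _ hr).ne'
    have hWt : W ≠ ∞ := measure_closedBall_lt_top.ne
    have hW'0 : W' ≠ 0 := (measure_closedBall_pos _ _ (by positivity)).ne'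
    have hW't : W' ≠ ∞ := measure_closedBall_lt_top.ne
    have hWW : W = D * W' := by
      rw [hW, hW', Measure.addHaar_closedBall _ _ hr.le,
        Measure.addHaar_closedBall _ _ (by positivity), ← mul_assoc, hD,
        ← ENNReal.ofReal_mul (by positivity), ← mul_pow]
      congr 3; ring
    set β := ENNReal.ofReal r ^ (1 / (p - 1)) with hβ
    have hr0 : ENNReal.ofReal r ≠ 0 := by simpa using hr
    have hβ0 : β ≠ 0 := (ENNReal.rpow_pos (pos_iff_ne_zero.2 hr0) (by finiteness)).ne'
    have hβt : β ≠ ∞ := ENNReal.rpow_ne_top_of_nonneg hp'.le (by finiteness)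
    have hβp : β ^ p = β * ENNReal.ofReal r := by
      rw [← mul_rpow_sub_one_self hp, hβ, ← ENNReal.rpow_mul, one_div_mul_cancel (by linarith),
        ENNReal.rpow_one]
    have hflux : ∫⁻ x in closedBall z r, ‖gradient u x‖ₑ ^ (p - 1) ≤
        ENNReal.ofReal r * (2 * s * W) := by
      refine (ENNReal.mul_le_mul_iff_right hβ0 hβt).1 ?_
      rw [← lintegral_const_mul' _ _ hβt]
      calc ∫⁻ x in closedBall z r, β * ‖gradient u x‖ₑ ^ (p - 1)
          ≤ ∫⁻ x in closedBall z r, (s * β ^ p + κ⁻¹ * ‖gradient u x‖ₑ ^ p) := by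
            refine lintegral_mono fun x => ?_
            rw [← hκs]
            exact mul_rpow_sub_one_le_weighted hp _ _ hκ0 hκt
        _ = s * β ^ p * W + κ⁻¹ * ∫⁻ x in closedBall z r, ‖gradient u x‖ₑ ^ p := by
            rw [lintegral_add_left measurable_const, setLIntegral_const,
              lintegral_const_mul' _ _ (ENNReal.inv_ne_top.2 hκ0)]
        _ ≤ s * β ^ p * W + κ⁻¹ * (κ * s * (W * β ^ p)) := by gcongr
        _ = s * β ^ p * W + κ⁻¹ * κ * (s * (W * β ^ p)) := by ring
        _ = β * (ENNReal.ofReal r * (2 * s * W)) := by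
            rw [ENNReal.inv_mul_cancel hκ0 hκt, hβp]; ring
    have hosc : ∫⁻ x in closedBall z r, ‖g x - g z‖ₑ ≤ s * W :=
      (ENNReal.div_le_iff hW0 hWt).1 hlr
    refine (ENNReal.mul_le_mul_iff_left hW'0 hW't).1 (hmain.trans ?_)
    have hMr : ENNReal.ofReal (C * C₀ / (r / 2)) * ENNReal.ofReal r = M := by
      rw [← ENNReal.ofReal_mul (by positivity), hM]
      congr 1; field_simp
    calc _ ≤ ENNReal.ofReal (C * C₀ / (r / 2)) * (ENNReal.ofReal r * (2 * s * W)) + s * W := by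
          gcongr
      _ = M * (2 * s * W) + s * W := by rw [← mul_assoc, hMr]
      _ = s * (D * (M * 2 + 1)) * W' := by rw [hWW]; ring
  have hz : ‖g z‖ₑ = 0 := by
    have lim : Filter.Tendsto (fun n : ℕ => (2⁻¹ : ℝ≥0∞) ^ n * (D * (M * 2 + 1))) Filter.atTop
        (𝓝 0) := by
      have := ENNReal.Tendsto.mul_const
        (ENNReal.tendsto_pow_atTop_nhds_zero_of_lt_one (r := 2⁻¹) (by simp)) (Or.inr hKt)
      rwa [zero_mul] at this
    exact le_antisymm (ge_of_tendsto' lim fun n => key _ (by simp) (by finiteness)) zero_le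
  simpa using hz

/-- The source of a weak solution vanishes almost everywhere on the critical set. -/
lemma ae_source_eq_zero_of_weak_formulation (hE : IsOpen E) (hu : ContDiffOn ℝ 1 u E) (hp : 1 < p)
    (hA : ∀ K ⊆ E, IsCompact K → IntegrableOn A K) (hg : IntegrableOn g E)
    (hbound : ∀ K ⊆ E, IsCompact K → ∃ c C : ℝ, 0 < c ∧ 0 ≤ C ∧ ∀ x ∈ K,
      c * ‖gradient u x‖ ^ p ≤ ⟪A x, gradient u x⟫ ∧ ‖A x‖ ≤ C * ‖gradient u x‖ ^ (p - 1) ∧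
        |g x| ≤ C)
    (hweak : ∀ φ : V → ℝ, ContDiff ℝ (⊤ : ℕ∞) φ → HasCompactSupport φ → tsupport φ ⊆ E →
      ∫ x in E, ⟪A x, gradient φ x⟫ = ∫ x in E, g x * φ x) :
    ∀ᵐ x ∂(volume.restrict {x | x ∈ E ∧ gradient u x = 0}), x ∈ E ∧ g x = 0 := by
  have hG := continuousOn_gradient_of_contDiffOn hE hu
  have hopen : IsOpen (E ∩ {x | gradient u x ≠ 0}) :=
    hG.isOpen_inter_preimage hE isOpen_compl_singleton
  have hcrit : MeasurableSet {x | x ∈ E ∧ gradient u x = 0} := by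
    have : {x | x ∈ E ∧ gradient u x = 0} = E \ (E ∩ {x | gradient u x ≠ 0}) := by
      ext x; simp
    rw [this]
    exact hE.measurableSet.diff hopen.measurableSet
  have hint : Integrable (E.indicator g) := (integrable_indicator_iff hE.measurableSet).2 hg
  refine (ae_restrict_iff' hcrit).2 ?_
  filter_upwards [Besicovitch.ae_tendsto_measure_inter_div_of_measurableSet volume
      hopen.measurableSet,
    (Besicovitch.vitaliFamily volume).ae_tendsto_lintegral_enorm_sub_div
      hint.locallyIntegrable] with z hd hl ⟨hzE, hz0⟩
  replace hl := hl.comp (Besicovitch.tendsto_filterAt volume z)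
  obtain ⟨R, hR, hRE⟩ := Metric.nhds_basis_closedBall.mem_iff.1 (hE.mem_nhds hzE)
  obtain ⟨c, C, hc, hC, hb⟩ := hbound _ hRE (isCompact_closedBall z R)
  have hs : IsFluxSolution E u A g p c C z R :=
    { isOpen := hE
      contDiffOn := hu
      one_lt := hp
      c_pos := hc
      C_nonneg := hC
      R_pos := hR
      ball_subset := hRE
      coercive := fun x hx => (hb x hx).1
      growth := fun x hx => (hb x hx).2.1
      source_le := fun x hx => (hb x hx).2.2
      integrableOn_flux := hA _ hRE (isCompact_closedBall z R)
      integrableOn_source := hg.mono_set hRE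
      weak := fun φ hφ hφc hφs => weak_formulation_C1 hE hA (fun K hK _ => hg.mono_set hK) hweak
        hφ hφc hφs }
  refine ⟨hzE, hs.source_eq_zero ?_ ?_⟩
  · rw [indicator_of_notMem (fun h => h.2 hz0)] at hd
    refine hd.congr' ?_
    filter_upwards [Ioo_mem_nhdsGT hR] with r hr
    congr 2
    ext x
    have : x ∈ closedBall z r → x ∈ E := fun hx => hRE (closedBall_subset_closedBall hr.2.le hx)
    simp only [mem_inter_iff]
    tauto
  · refine hl.congr' ?_
    filter_upwards [Ioo_mem_nhdsGT hR] with r hr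
    simp only [Function.comp_apply]
    congr 1
    refine setLIntegral_congr_fun measurableSet_closedBall fun x hx => ?_
    simp only [indicator_of_mem hzE,
      indicator_of_mem (hRE (closedBall_subset_closedBall hr.2.le hx))]

end Flux

section Norm

variable {N : ℕ} {H : EuclideanSpace ℝ (Fin N) → ℝ}

lemma IsAnisoNorm.map_zero (hH : IsAnisoNorm H) : H 0 = 0 := by
  simpa using hH.hom 0 0

lemma IsAnisoNorm.add_le (hH : IsAnisoNorm H) (x y : EuclideanSpace ℝ (Fin N)) :
    H (x + y) ≤ H x + H y := by
  have h := hH.conv.2 (mem_univ ((2 : ℝ) • x)) (mem_univ ((2 : ℝ) • y))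
    (show (0 : ℝ) ≤ 1 / 2 by norm_num) (show (0 : ℝ) ≤ 1 / 2 by norm_num) (by norm_num)
  rw [smul_smul, smul_smul, hH.hom, hH.hom] at h
  norm_num at h
  linarith

lemma IsAnisoNorm.exists_bounds (hH : IsAnisoNorm H) (hc : ContinuousOn H {0}ᶜ) :
    ∃ m M : ℝ, 0 < m ∧ 0 ≤ M ∧ ∀ ξ, m * ‖ξ‖ ≤ H ξ ∧ H ξ ≤ M * ‖ξ‖ := by
  have hcs : IsCompact (sphere (0 : EuclideanSpace ℝ (Fin N)) 1) := isCompact_sphere _ _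
  have hne : ∀ ξ ∈ sphere (0 : EuclideanSpace ℝ (Fin N)) 1, ξ ≠ 0 :=
    fun ξ hξ => ne_zero_of_mem_unit_sphere ⟨ξ, hξ⟩
  have hcont : ContinuousOn H (sphere 0 1) := hc.mono hne
  obtain ⟨m, hm, hmle⟩ := hcs.exists_forall_le' hcont fun ξ hξ => hH.pos ξ (hne ξ hξ)
  obtain ⟨M, hM⟩ := hcs.exists_bound_of_continuousOn hcont
  refine ⟨m, |M|, hm, abs_nonneg M, fun ξ => ?_⟩
  by_cases hξ : ξ = 0
  · simp [hξ, hH.map_zero]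
  have hn : 0 < ‖ξ‖ := norm_pos_iff.2 hξ
  have hmem : ‖ξ‖⁻¹ • ξ ∈ sphere (0 : EuclideanSpace ℝ (Fin N)) 1 := by
    rw [mem_sphere_zero_iff_norm, norm_smul, norm_inv, norm_norm, inv_mul_cancel₀ hn.ne']
  have e : H ξ = H (‖ξ‖⁻¹ • ξ) * ‖ξ‖ := by
    rw [hH.hom, abs_of_pos (by positivity), mul_comm, ← mul_assoc, mul_inv_cancel₀ hn.ne', one_mul]
  rw [e]
  constructor
  · gcongr
    exact hmle _ hmem
  · gcongr
    exact (le_abs_self _).trans ((hM _ hmem).trans (le_abs_self M))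

lemma IsAnisoNorm.norm_gradient_le (hH : IsAnisoNorm H) {M : ℝ} (hM : 0 ≤ M)
    (hle : ∀ ξ, H ξ ≤ M * ‖ξ‖) (ξ : EuclideanSpace ℝ (Fin N)) : ‖gradient H ξ‖ ≤ M := by
  rw [gradient, LinearIsometryEquiv.norm_map]
  refine norm_fderiv_le_of_lip' ℝ hM (Filter.Eventually.of_forall fun x => ?_)
  rw [Real.norm_eq_abs, abs_sub_le_iff]
  have h1 := hH.add_le (x - ξ) ξ
  have h2 := hH.add_le (ξ - x) x
  rw [sub_add_cancel] at h1 h2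
  have h3 := hle (ξ - x)
  rw [norm_sub_rev] at h3
  constructor <;> linarith [hle (x - ξ)]

/-- Euler's identity for the norm `H`. -/
lemma IsAnisoNorm.inner_gradient_self (hH : IsAnisoNorm H) {ξ : EuclideanSpace ℝ (Fin N)}
    (hd : DifferentiableAt ℝ H ξ) : ⟪gradient H ξ, ξ⟫ = H ξ := by
  rw [gradient, InnerProductSpace.toDual_symm_apply]
  have h1 : HasDerivAt (fun t : ℝ => H (t • ξ)) (fderiv ℝ H ξ ξ) 1 := by
    have h2 : HasDerivAt (fun t : ℝ => t • ξ) ξ 1 := by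
      simpa using (hasDerivAt_id (1 : ℝ)).smul_const ξ
    have h3 : HasFDerivAt H (fderiv ℝ H ξ) ((1 : ℝ) • ξ) := by
      rw [one_smul]; exact hd.hasFDerivAt
    exact h3.comp_hasDerivAt 1 h2
  have h4 : HasDerivAt (fun t : ℝ => H (t • ξ)) (H ξ) 1 := by
    have h5 : HasDerivAt (fun t : ℝ => t * H ξ) (H ξ) 1 := by
      simpa using (hasDerivAt_id (1 : ℝ)).mul_const (H ξ)
    refine h5.congr_of_eventuallyEq ?_
    filter_upwards [lt_mem_nhds (zero_lt_one' ℝ)] with t ht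
    rw [hH.hom, abs_of_pos ht]
  exact h1.unique h4

/-- The flux `H(ξ)^{p-1} ∇H(ξ)`, extended by `0` at the origin. -/
def anisoFlux (H : EuclideanSpace ℝ (Fin N) → ℝ) (p : ℝ) (ξ : EuclideanSpace ℝ (Fin N)) :
    EuclideanSpace ℝ (Fin N) :=
  if ξ = 0 then 0 else H ξ ^ (p - 1) • gradient H ξ

lemma IsAnisoNorm.exists_anisoFlux_bounds (hH : IsAnisoNorm H)
    (hd : ContDiffOn ℝ 2 H {0}ᶜ) {p : ℝ} (hp : 1 < p) :
    ∃ c C : ℝ, 0 < c ∧ 0 ≤ C ∧ ∀ ξ, c * ‖ξ‖ ^ p ≤ ⟪anisoFlux H p ξ, ξ⟫ ∧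
      ‖anisoFlux H p ξ‖ ≤ C * ‖ξ‖ ^ (p - 1) := by
  obtain ⟨m, M, hm, hM, hmM⟩ := hH.exists_bounds hd.continuousOn
  refine ⟨m ^ p, M ^ (p - 1) * M, by positivity, by positivity, fun ξ => ?_⟩
  by_cases hξ : ξ = 0
  · simp [hξ, anisoFlux, Real.zero_rpow (show p ≠ 0 by linarith),
      Real.zero_rpow (show p - 1 ≠ 0 by linarith)]
  have hpos := hH.pos ξ hξ
  have hdiff : DifferentiableAt ℝ H ξ :=
    (hd.contDiffAt (isOpen_compl_singleton.mem_nhds hξ)).differentiableAt two_ne_zero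
  rw [anisoFlux, if_neg hξ]
  constructor
  · rw [real_inner_smul_left, hH.inner_gradient_self hdiff, ← Real.rpow_add_one hpos.ne',
      sub_add_cancel, ← Real.mul_rpow hm.le (norm_nonneg _)]
    exact Real.rpow_le_rpow (by positivity) (hmM ξ).1 (by linarith)
  · rw [norm_smul, Real.norm_of_nonneg (by positivity), mul_right_comm,
      ← Real.mul_rpow hM (norm_nonneg _)]
    exact mul_le_mul (Real.rpow_le_rpow hpos.le (hmM ξ).2 (by linarith))
      (hH.norm_gradient_le hM (fun η => (hmM η).2) ξ) (norm_nonneg _)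
      (Real.rpow_nonneg (by positivity) _)

lemma measurable_anisoFlux (hd : ContDiffOn ℝ 2 H {0}ᶜ) {p : ℝ} (hp : 1 < p) :
    Measurable (anisoFlux H p) := by
  have : anisoFlux H p = ({0} : Set (EuclideanSpace ℝ (Fin N))).piecewise (fun _ => 0)
      fun ξ => H ξ ^ (p - 1) • gradient H ξ := by
    ext1 ξ
    simp [anisoFlux, Set.piecewise]
  rw [this]
  refine ContinuousOn.measurable_piecewise continuousOn_const ?_ (measurableSet_singleton 0)
  exact (hd.continuousOn.rpow_const fun _ _ => Or.inr (by linarith)).smul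
    (continuousOn_gradient_of_contDiffOn isOpen_compl_singleton (hd.of_le one_le_two))

end Norm

/-- the nonlinearity vanishes a.e. on the critical set
(Lemma 3.2 of the paper, generalizing Lou's result). -/
theorem nonlinearity_vanishes_on_critical_set
    {N : ℕ} (p : ℝ) (hp : 1 < p)
    (H : EuclideanSpace ℝ (Fin N) → ℝ)
    (hH : IsAnisoNorm H) (hHell : UniformlyElliptic H)
    (E : Set (EuclideanSpace ℝ (Fin N)))
    (hEo : IsOpen E) (hEc : IsConnected E) (hEb : Bornology.IsBounded E)
    (f : ℝ → ℝ) (hfm : Measurable f)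
    (hfb : ∀ K : Set ℝ, IsCompact K → ∃ C, ∀ s ∈ K, |f s| ≤ C)
    (w : EuclideanSpace ℝ (Fin N) → ℝ)
    (hwc : ContinuousOn w (closure E))
    (hwpos : ∀ x ∈ E, 0 < w x)
    (hwlip : ∀ x ∈ E, ∃ K : ℝ≥0, ∃ ε > 0, LipschitzOnWith K w (Metric.ball x ε ∩ E))
    (u : EuclideanSpace ℝ (Fin N) → ℝ)
    (hub : ∃ C, ∀ x ∈ E, |u x| ≤ C)
    (hu1 : ContDiffOn ℝ 1 u E)
    (hweak : ∀ φ : EuclideanSpace ℝ (Fin N) → ℝ,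
      ContDiff ℝ (⊤ : ℕ∞) φ → HasCompactSupport φ → tsupport φ ⊆ E →
      ∫ x in E, w x * ⟪aField H p u x, gradient φ x⟫ =
        ∫ x in E, f (u x) * φ x * w x) :
    ∀ᵐ x ∂(volume.restrict {x | x ∈ E ∧ gradient u x = 0}), f (u x) = 0 := by
  obtain ⟨c, C, hc, hC, hflux⟩ := hH.exists_anisoFlux_bounds hHell.1 hp
  have hG := continuousOn_gradient_of_contDiffOn hEo hu1
  have hwE : ContinuousOn w E := hwc.mono subset_closure
  obtain ⟨W, hW⟩ := hEb.isCompact_closure.exists_bound_of_continuousOn hwc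
  replace hW : ∀ x ∈ E, w x ≤ |W| := fun x hx =>
    (le_abs_self _).trans ((hW x (subset_closure hx)).trans (le_abs_self W))
  obtain ⟨U, hU⟩ := hub
  obtain ⟨F, hF⟩ := hfb (Icc (-U) U) isCompact_Icc
  replace hF : ∀ x ∈ E, |f (u x)| ≤ |F| := fun x hx =>
    (hF _ (abs_le.1 (hU x hx))).trans (le_abs_self F)
  set A : EuclideanSpace ℝ (Fin N) → EuclideanSpace ℝ (Fin N) :=
    fun x => w x • anisoFlux H p (gradient u x) with hA
  set g : EuclideanSpace ℝ (Fin N) → ℝ := fun x => f (u x) * w x with hg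
  have hgle : ∀ x ∈ E, |g x| ≤ |F| * |W| := fun x hx => by
    rw [hg, abs_mul, abs_of_pos (hwpos x hx)]
    exact mul_le_mul (hF x hx) (hW x hx) (hwpos x hx).le (abs_nonneg _)
  have hAle : ∀ x ∈ E, ‖A x‖ ≤ |W| * C * ‖gradient u x‖ ^ (p - 1) := fun x hx => by
    rw [hA, norm_smul, Real.norm_of_nonneg (hwpos x hx).le, mul_assoc]
    exact mul_le_mul (hW x hx) (hflux _).2 (norm_nonneg _) (abs_nonneg _)
  have hAm : AEStronglyMeasurable A (volume.restrict E) :=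
    (hwE.aestronglyMeasurable hEo.measurableSet).smul
      ((measurable_anisoFlux hHell.1 hp).comp_aemeasurable
        (hG.aemeasurable hEo.measurableSet)).aestronglyMeasurable
  have hgm : AEStronglyMeasurable g (volume.restrict E) :=
    (hfm.comp_aemeasurable
      (hu1.continuousOn.aemeasurable hEo.measurableSet)).aestronglyMeasurable.mul
      (hwE.aestronglyMeasurable hEo.measurableSet)
  have hgint : IntegrableOn g E :=
    IntegrableOn.of_bound hEb.measure_lt_top hgm _
      ((ae_restrict_iff' hEo.measurableSet).2 (Filter.Eventually.of_forall hgle))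
  have hAint : ∀ K ⊆ E, IsCompact K → IntegrableOn A K := by
    intro K hKE hK
    obtain ⟨D, hD⟩ := hK.exists_bound_of_continuousOn (hG.mono hKE)
    refine IntegrableOn.of_bound hK.measure_lt_top
      (hAm.mono_measure (Measure.restrict_mono hKE le_rfl)) (|W| * C * D ^ (p - 1))
      ((ae_restrict_iff' hK.measurableSet).2 (Filter.Eventually.of_forall fun x hx => ?_))
    refine (hAle x (hKE hx)).trans ?_
    gcongr
    exact hD x hx
  have hbound : ∀ K ⊆ E, IsCompact K → ∃ c C : ℝ, 0 < c ∧ 0 ≤ C ∧ ∀ x ∈ K,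
      c * ‖gradient u x‖ ^ p ≤ ⟪A x, gradient u x⟫ ∧ ‖A x‖ ≤ C * ‖gradient u x‖ ^ (p - 1) ∧
        |g x| ≤ C := by
    intro K hKE hK
    obtain ⟨m, hm, hmle⟩ := hK.exists_forall_le' (hwE.mono hKE) fun x hx => hwpos x (hKE hx)
    refine ⟨m * c, max (|W| * C) (|F| * |W|), by positivity, by positivity, fun x hx => ⟨?_, ?_,
      (hgle x (hKE hx)).trans (le_max_right _ _)⟩⟩
    · rw [hA, real_inner_smul_left, mul_assoc]
      exact mul_le_mul (hmle x hx) (hflux _).1 (by positivity) (hwpos x (hKE hx)).le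
    · refine (hAle x (hKE hx)).trans ?_
      gcongr
      exact le_max_left _ _
  have hweak' : ∀ φ : EuclideanSpace ℝ (Fin N) → ℝ, ContDiff ℝ (⊤ : ℕ∞) φ →
      HasCompactSupport φ → tsupport φ ⊆ E →
      ∫ x in E, ⟪A x, gradient φ x⟫ = ∫ x in E, g x * φ x := by
    intro φ hφ hφc hφs
    simp only [hA, hg, real_inner_smul_left, mul_right_comm (f _) (w _) (φ _)]
    exact hweak φ hφ hφc hφs
  filter_upwards [ae_source_eq_zero_of_weak_formulation hEo hu1 hp hAint hgint hbound hweak']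
    with x hx
  exact (mul_eq_zero.1 hx.2).resolve_right (hwpos x hx.1).ne'
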